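/- arXiv:1211.4383 — 8 statements merged into one kernel-verified Lean document; each statement's English description precedes it below -/
import Mathlib

section
/- Let V be a real inner product space and let R ⊆ V be a root system all of whose elements have square length 1 or 2. Let n ≥ 1 and let β, α₁, …, αₙ ∈ V be such that: (i) the 4n vectors ε·αᵢ + ε′·β (1 ≤ i ≤ n, ε, ε′ ∈ {1, −1}) are pairwise distinct and all lie in R; denote by W the set of these 4n vectors and set S := R \ W; (ii) S is closed; (iii) ⟨β, αᵢ⟩ ≥ 0 for all i; (iv) there exist w₁, w₂, w₃ ∈ W with w₁ + w₂ = w₃. Then n = 3, β = α₁ + α₂ + α₃, ⟨β, αᵢ⟩ = 1/4 and ‖αᵢ‖² = 3/4 for i = 1, 2, 3, ‖β‖² = 3/4, and ⟨αᵢ, αⱼ⟩ = −1/4 for all i ≠ j. -/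
open scoped RealInnerProductSpace

/-- A root system in a real inner product space `V`: a finite set `R ⊆ V` with
`0 ∉ R` (R1), the only multiples of a root in `R` being `±` that root (R2),
integrality of `2⟨α,β⟩/⟨α,α⟩` (R3), and stability under reflections (R4). -/
def IsRootSystem {V : Type*} [NormedAddCommGroup V] [InnerProductSpace ℝ V]
    (R : Set V) : Prop :=
  R.Finite ∧ (0 : V) ∉ R ∧
  (∀ a ∈ R, ∀ t : ℝ, t • a ∈ R → t • a = a ∨ t • a = -a) ∧
  (∀ a ∈ R, ∀ b ∈ R, ∃ k : ℤ, 2 * ⟪a, b⟫ / ⟪a, a⟫ = (k : ℝ)) ∧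
  (∀ a ∈ R, ∀ b ∈ R, b - (2 * ⟪a, b⟫ / ⟪a, a⟫) • a ∈ R)

/-- `S` is a closed subset of the root system `R`: whenever `x, y ∈ S` and
`x + y ∈ R`, also `x + y ∈ S`. -/
def IsClosedIn {V : Type*} [NormedAddCommGroup V] [InnerProductSpace ℝ V]
    (R S : Set V) : Prop :=
  ∀ x ∈ S, ∀ y ∈ S, x + y ∈ R → x + y ∈ S

namespace IsRootSystem

variable {V : Type*} [NormedAddCommGroup V] [InnerProductSpace ℝ V] {R : Set V}

theorem ne_zero (hR : IsRootSystem R) {x : V} (hx : x ∈ R) : x ≠ 0 := by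
  rintro rfl
  exact hR.2.1 hx

theorem reflection_mem (hR : IsRootSystem R) {x y : V} (hx : x ∈ R) (hy : y ∈ R) {c : ℝ}
    (hc : 2 * ⟪x, y⟫ = c * ⟪x, x⟫) : y - c • x ∈ R := by
  have h := hR.2.2.2.2 x hx y hy
  have h0 : ⟪x, x⟫ ≠ 0 := inner_self_ne_zero.mpr (hR.ne_zero hx)
  rwa [hc, mul_div_cancel_right₀ _ h0] at h

theorem neg_mem (hR : IsRootSystem R) {x : V} (hx : x ∈ R) : -x ∈ R := by
  have h := hR.reflection_mem hx hx (c := 2) rfl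
  rwa [two_smul, sub_add_cancel_left] at h

theorem two_smul_notMem (hR : IsRootSystem R) {x : V} (hx : x ∈ R) : (2 : ℝ) • x ∉ R := by
  intro h
  have h0 := hR.ne_zero hx
  rcases hR.2.2.1 x hx 2 h with h | h
  · apply h0
    linear_combination (norm := module) (1 : ℝ) • h
  · have : (3 : ℝ) • x = 0 := by linear_combination (norm := module) (1 : ℝ) • h
    exact h0 ((smul_eq_zero.mp this).resolve_left (by norm_num))

theorem inner_eq_intCast (hR : IsRootSystem R) {x y : V} (hx : x ∈ R) (hy : y ∈ R)
    (h : ⟪x, x⟫ = 2) : ∃ k : ℤ, ⟪x, y⟫ = k := by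
  obtain ⟨k, hk⟩ := hR.2.2.2.1 x hx y hy
  refine ⟨k, ?_⟩
  rw [← hk, h]
  ring

theorem two_mul_inner_eq_intCast (hR : IsRootSystem R) {x y : V} (hx : x ∈ R) (hy : y ∈ R)
    (h : ⟪x, x⟫ = 1) : ∃ k : ℤ, 2 * ⟪x, y⟫ = k := by
  obtain ⟨k, hk⟩ := hR.2.2.2.1 x hx y hy
  refine ⟨k, ?_⟩
  rw [← hk, h]
  ring

theorem inner_sq_lt (hR : IsRootSystem R) {x y : V} (hx : x ∈ R) (hy : y ∈ R)
    (h₁ : x ≠ y) (h₂ : x ≠ -y) : ⟪x, y⟫ ^ 2 < ⟪x, x⟫ * ⟪y, y⟫ := by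
  have hle : ⟪x, y⟫ ^ 2 ≤ ⟪x, x⟫ * ⟪y, y⟫ := by
    rw [sq]
    exact real_inner_mul_inner_self_le x y
  refine lt_of_le_of_ne hle fun heq => ?_
  have hy0 : ⟪y, y⟫ ≠ 0 := inner_self_ne_zero.mpr (hR.ne_zero hy)
  have hz : x - (⟪x, y⟫ / ⟪y, y⟫) • y = 0 := by
    rw [← inner_self_eq_zero (𝕜 := ℝ)]
    simp only [inner_sub_left, inner_sub_right, real_inner_smul_left, real_inner_smul_right,
      real_inner_comm x y]
    field_simp
    linear_combination -heq
  have hxy := sub_eq_zero.mp hz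
  have := hR.2.2.1 y hy (⟪x, y⟫ / ⟪y, y⟫) (hxy ▸ hx)
  rw [← hxy] at this
  exact this.elim h₁ h₂

/-- The possible Gram matrices of `a, b` when `a + b` and `a - b` are roots of
square lengths in `{1, 2}`. -/
theorem inner_cases (hR : IsRootSystem R) (hlen : ∀ r ∈ R, ⟪r, r⟫ = 1 ∨ ⟪r, r⟫ = 2) {a b : V}
    (ha : a ≠ 0) (hb : b ≠ 0) (hp : a + b ∈ R) (hm : a - b ∈ R) (h : 0 ≤ ⟪b, a⟫) :
    (⟪b, a⟫ = 1 / 4 ∧ (⟪b, b⟫ = 1 / 4 ∧ ⟪a, a⟫ = 5 / 4 ∨ ⟪b, b⟫ = 3 / 4 ∧ ⟪a, a⟫ = 3 / 4 ∨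
      ⟪b, b⟫ = 5 / 4 ∧ ⟪a, a⟫ = 1 / 4)) ∨
    (⟪b, a⟫ = 0 ∧ (⟪b, b⟫ = 1 / 4 ∨ ⟪b, b⟫ = 1 / 2 ∨ ⟪b, b⟫ = 3 / 4 ∧ ⟪a, a⟫ = 1 / 4 ∨
      ⟪b, b⟫ = 1 ∨ ⟪b, b⟫ = 3 / 2)) := by
  have hlt := hR.inner_sq_lt hp hm
    (fun h => hb (by linear_combination (norm := module) (1 / 2 : ℝ) • h))
    (fun h => ha (by linear_combination (norm := module) (1 / 2 : ℝ) • h))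
  have hp' := hlen _ hp
  have hm' := hlen _ hm
  have hi₁ := hR.two_mul_inner_eq_intCast hp hm
  have hi₂ := hR.inner_eq_intCast hp hm
  have hc : ⟪a, b⟫ = ⟪b, a⟫ := real_inner_comm _ _
  simp only [inner_sub_left, inner_sub_right, inner_add_left, inner_add_right, hc]
    at hlt hp' hm' hi₁ hi₂
  generalize ⟪b, a⟫ = x at *
  generalize ⟪a, a⟫ = A at *
  generalize ⟪b, b⟫ = B at *
  rcases hp' with hp' | hp'
  · obtain ⟨k, hk⟩ := hi₁ hp'
    rcases hm' with hm' | hm'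
    · rw [hp', hm'] at hlt
      have hk' : ((k : ℝ)) ^ 2 < 4 := by rw [← hk]; linarith
      have hk2 : k ^ 2 < 4 := by exact_mod_cast hk'
      have : -2 < k := by nlinarith
      have : k < 2 := by nlinarith
      interval_cases k <;> norm_num at hk
      · right; exact ⟨by linarith, Or.inr (Or.inr (Or.inl ⟨by linarith, by linarith⟩))⟩
      · right; exact ⟨by linarith, Or.inr (Or.inl (by linarith))⟩
      · right; exact ⟨by linarith, Or.inl (by linarith)⟩
    · linarith
  · obtain ⟨k, hk⟩ := hi₂ hp'
    rcases hm' with hm' | hm'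
    · rw [hp', hm', hk] at hlt
      have hk2 : k ^ 2 < 2 * 1 := by exact_mod_cast hlt
      have : -2 < k := by nlinarith
      have : k < 2 := by nlinarith
      left
      refine ⟨by linarith, ?_⟩
      interval_cases k <;> norm_num at hk
      · right; right; constructor <;> linarith
      · right; left; constructor <;> linarith
      · left; constructor <;> linarith
    · rw [hp', hm', hk] at hlt
      have hk2 : k ^ 2 < 2 * 2 := by exact_mod_cast hlt
      have : -2 < k := by nlinarith
      have : k < 2 := by nlinarith
      right
      refine ⟨by linarith, ?_⟩
      interval_cases k <;> norm_num at hk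
      · right; right; right; right; linarith
      · right; right; right; left; linarith
      · right; left; linarith

end IsRootSystem

/-- The vectors `± α i ± β` with `i ∈ I` are pairwise distinct roots of `R`, `⟪β, α i⟫ ≥ 0`, and
no such vector is the sum of two roots not of this form. -/
structure IsCoclosedFamily {V : Type*} [NormedAddCommGroup V] [InnerProductSpace ℝ V]
    (R : Set V) (I : Finset ℕ) (α : ℕ → V) (β : V) : Prop where
  root : IsRootSystem R
  len : ∀ r ∈ R, ⟪r, r⟫ = 1 ∨ ⟪r, r⟫ = 2
  mem : ∀ i ∈ I, ∀ s t : ℝ, (s = 1 ∨ s = -1) → (t = 1 ∨ t = -1) → s • α i + t • β ∈ R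
  inj : ∀ i ∈ I, ∀ j ∈ I, ∀ s t u v : ℝ,
    (s = 1 ∨ s = -1) → (t = 1 ∨ t = -1) → (u = 1 ∨ u = -1) → (v = 1 ∨ v = -1) →
    s • α i + t • β = u • α j + v • β → i = j ∧ s = u ∧ t = v
  coclosed : ∀ x ∈ R, ∀ y ∈ R, ∀ i ∈ I, ∀ s t : ℝ, (s = 1 ∨ s = -1) → (t = 1 ∨ t = -1) →
    x + y = s • α i + t • β → ∃ k ∈ I, ∃ u v : ℝ, (u = 1 ∨ u = -1) ∧ (v = 1 ∨ v = -1) ∧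
      (x = u • α k + v • β ∨ y = u • α k + v • β)
  nonneg : ∀ i ∈ I, 0 ≤ ⟪β, α i⟫

namespace IsCoclosedFamily

variable {V : Type*} [NormedAddCommGroup V] [InnerProductSpace ℝ V] {R : Set V} {I : Finset ℕ}
  {α : ℕ → V} {β : V}

theorem add_mem (h : IsCoclosedFamily R I α β) {i : ℕ} (hi : i ∈ I) : α i + β ∈ R := by
  simpa using h.mem i hi 1 1 (by simp) (by simp)

theorem sub_mem (h : IsCoclosedFamily R I α β) {i : ℕ} (hi : i ∈ I) : α i - β ∈ R := by
  simpa [sub_eq_add_neg] using h.mem i hi 1 (-1) (by simp) (by simp)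

theorem alpha_ne_zero (h : IsCoclosedFamily R I α β) {i : ℕ} (hi : i ∈ I) : α i ≠ 0 := by
  intro h0
  have := h.inj i hi i hi 1 1 (-1) 1 (by simp) (by simp) (by simp) (by simp) (by simp [h0])
  norm_num at this

theorem beta_ne_zero (h : IsCoclosedFamily R I α β) {i : ℕ} (hi : i ∈ I) : β ≠ 0 := by
  intro h0
  have := h.inj i hi i hi 1 1 1 (-1) (by simp) (by simp) (by simp) (by simp) (by simp [h0])
  norm_num at this

theorem inner_cases (h : IsCoclosedFamily R I α β) {i : ℕ} (hi : i ∈ I) :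
    (⟪β, α i⟫ = 1 / 4 ∧ (⟪β, β⟫ = 1 / 4 ∧ ⟪α i, α i⟫ = 5 / 4 ∨
      ⟪β, β⟫ = 3 / 4 ∧ ⟪α i, α i⟫ = 3 / 4 ∨ ⟪β, β⟫ = 5 / 4 ∧ ⟪α i, α i⟫ = 1 / 4)) ∨
    (⟪β, α i⟫ = 0 ∧ (⟪β, β⟫ = 1 / 4 ∨ ⟪β, β⟫ = 1 / 2 ∨ ⟪β, β⟫ = 3 / 4 ∧ ⟪α i, α i⟫ = 1 / 4 ∨
      ⟪β, β⟫ = 1 ∨ ⟪β, β⟫ = 3 / 2)) :=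
  h.root.inner_cases h.len (h.alpha_ne_zero hi) (h.beta_ne_zero hi) (h.add_mem hi) (h.sub_mem hi)
    (h.nonneg i hi)

theorem inner_eq_zero_of_quarter (h : IsCoclosedFamily R I α β) (hβ : ⟪β, β⟫ = 1 / 4) {i : ℕ}
    (hi : i ∈ I) : ⟪β, α i⟫ = 0 := by
  rcases h.inner_cases hi with ⟨hx, hc⟩ | ⟨hx, -⟩
  swap
  · exact hx
  exfalso
  have ha : ⟪α i, α i⟫ = 5 / 4 := by
    rcases hc with hc | hc | hc <;> linarith
  have hc : ⟪α i, β⟫ = 1 / 4 := by rw [real_inner_comm, hx]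
  have h₁ : α i - (3 : ℝ) • β ∈ R := by
    have := h.root.neg_mem (h.root.reflection_mem (h.sub_mem hi) (h.add_mem hi) (c := 2) (by
      simp only [inner_sub_left, inner_sub_right, inner_add_right, hx, hc, ha, hβ]
      norm_num))
    convert this using 1
    module
  have h₂ : (2 : ℝ) • β ∈ R := by
    have := h.root.neg_mem (h.root.reflection_mem (h.add_mem hi) (h.sub_mem hi) (c := 1) (by
      simp only [inner_add_left, inner_sub_right, inner_add_right, hx, hc, ha, hβ]
      norm_num))
    convert this using 1
    module
  obtain ⟨k, hk, u, v, hu, hv, hkuv⟩ := h.coclosed _ h₁ _ h₂ i hi 1 (-1) (by simp) (by simp)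
    (by module)
  have hk' : ⟪β, α k⟫ = 0 ∨ ⟪β, α k⟫ = 1 / 4 := by
    rcases h.inner_cases hk with h' | h'
    · exact Or.inr h'.1
    · exact Or.inl h'.1
  rcases hkuv with he | he
  · have hin := congrArg (fun z => ⟪β, z⟫) he
    simp only [inner_sub_right, inner_add_right, real_inner_smul_right, hβ, hx] at hin
    have huv : u = -1 ∧ v = -1 := by
      rcases hu with rfl | rfl <;> rcases hv with rfl | rfl <;> rcases hk' with h' | h' <;>
        rw [h'] at hin <;> first | (norm_num; done) | norm_num at hin
    obtain ⟨rfl, rfl⟩ := huv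
    have := h.inj k hk i hi (-1) 1 1 (-1) (by simp) (by simp) (by simp) (by simp)
      (by linear_combination (norm := module) (-1 : ℝ) • he)
    norm_num at this
  · have hin := congrArg (fun z => ⟪β, z⟫) he
    simp only [inner_add_right, real_inner_smul_right, hβ] at hin
    have huv : u = 1 ∧ v = 1 := by
      rcases hu with rfl | rfl <;> rcases hv with rfl | rfl <;> rcases hk' with h' | h' <;>
        rw [h'] at hin <;> first | (norm_num; done) | norm_num at hin
    obtain ⟨rfl, rfl⟩ := huv
    exact h.root.ne_zero (h.sub_mem hk) (by linear_combination (norm := module) (-1 : ℝ) • he)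

theorem smul_beta_ne (h : IsCoclosedFamily R I α β) {k : ℕ} (hk : k ∈ I) {s t c : ℝ}
    (hs : s = 1 ∨ s = -1) (ht : t = 1 ∨ t = -1) (hc : c = 1 ∨ c = -1) :
    (2 * c) • β ≠ s • α k + t • β := by
  intro he
  have hct : c = t ∨ c = -t := by
    rcases hc with rfl | rfl <;> rcases ht with rfl | rfl <;> norm_num
  rcases hct with rfl | rfl
  · have hc' : -c = 1 ∨ -c = -1 := by
      rcases hc with rfl | rfl <;> norm_num
    refine h.root.ne_zero (h.mem k hk s (-c) hs hc') ?_
    linear_combination (norm := module) (-1 : ℝ) • he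
  · have h₂ : (2 * -t) • β ∈ R := by
      rw [he]
      exact h.mem k hk s t hs ht
    apply h.root.two_smul_notMem h₂
    have : (2 : ℝ) • (2 * -t) • β = s • α k + (-t) • β := by
      linear_combination (norm := module) (1 : ℝ) • he
    rw [this]
    exact h.mem k hk s (-t) hs hc

theorem index_ne (h : IsCoclosedFamily R I α β) {i j k : ℕ} (hi : i ∈ I) (hk : k ∈ I)
    {s₁ t₁ s₂ t₂ s₃ t₃ : ℝ} (hs₁ : s₁ = 1 ∨ s₁ = -1) (ht₁ : t₁ = 1 ∨ t₁ = -1)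
    (hs₂ : s₂ = 1 ∨ s₂ = -1) (ht₂ : t₂ = 1 ∨ t₂ = -1) (hs₃ : s₃ = 1 ∨ s₃ = -1)
    (ht₃ : t₃ = 1 ∨ t₃ = -1)
    (he : (s₁ • α i + t₁ • β) + (s₂ • α j + t₂ • β) = s₃ • α k + t₃ • β) : i ≠ j := by
  rintro rfl
  have hneg : ∀ {t : ℝ}, t = 1 ∨ t = -1 → -t = 1 ∨ -t = -1 := by
    rintro t (rfl | rfl) <;> norm_num
  have hpm : ∀ {s t : ℝ}, s = 1 ∨ s = -1 → t = 1 ∨ t = -1 → t = s ∨ t = -s := by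
    rintro s t (rfl | rfl) (rfl | rfl) <;> norm_num
  have h₃ := h.mem k hk s₃ t₃ hs₃ ht₃
  rcases hpm hs₁ hs₂ with rfl | rfl <;> rcases hpm ht₁ ht₂ with rfl | rfl
  · apply h.root.two_smul_notMem (h.mem i hi _ _ hs₁ ht₁)
    rw [two_smul, he]
    exact h₃
  · apply h.root.two_smul_notMem (h.mem i hi _ _ hs₁ (hneg ht₃))
    have : (2 : ℝ) • (s₂ • α i + -t₃ • β) = s₃ • α k + (-t₃) • β := by
      linear_combination (norm := module) (1 : ℝ) • he
    rw [this]
    exact h.mem k hk _ _ hs₃ (hneg ht₃)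
  · refine h.smul_beta_ne hk hs₃ ht₃ ht₁ ?_
    rw [← he]
    module
  · apply h.root.ne_zero h₃
    rw [← he]
    module

theorem alpha_inner_alpha (h : IsCoclosedFamily R I α β) {k l : ℕ} (hk : k ∈ I) (hl : l ∈ I)
    (hkl : k ≠ l) (hβ : ⟪β, β⟫ = 3 / 4) (hxk : ⟪β, α k⟫ = 1 / 4) (hxl : ⟪β, α l⟫ = 1 / 4)
    (hk₂ : ⟪α k, α k⟫ = 3 / 4) (hl₂ : ⟪α l, α l⟫ = 3 / 4) : ⟪α k, α l⟫ = -(1 / 4) := by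
  have hck : ⟪α k, β⟫ = 1 / 4 := by rw [real_inner_comm, hxk]
  have hcl : ⟪α l, β⟫ = 1 / 4 := by rw [real_inner_comm, hxl]
  have h₁ := h.root.inner_sq_lt (h.add_mem hk) (h.add_mem hl)
    (fun he => hkl (h.inj k hk l hl 1 1 1 1 (by simp) (by simp) (by simp) (by simp)
      (by simpa using he)).1)
    (fun he => hkl (h.inj k hk l hl 1 1 (-1) (-1) (by simp) (by simp) (by simp) (by simp)
      (by linear_combination (norm := module) (1 : ℝ) • he)).1)
  have h₂ := h.root.inner_sq_lt (h.sub_mem hk) (h.sub_mem hl)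
    (fun he => hkl (h.inj k hk l hl 1 (-1) 1 (-1) (by simp) (by simp) (by simp) (by simp)
      (by linear_combination (norm := module) (1 : ℝ) • he)).1)
    (fun he => hkl (h.inj k hk l hl 1 (-1) (-1) 1 (by simp) (by simp) (by simp) (by simp)
      (by linear_combination (norm := module) (1 : ℝ) • he)).1)
  obtain ⟨m, hm⟩ := h.root.inner_eq_intCast (h.add_mem hk) (h.add_mem hl) (by
    simp only [inner_add_left, inner_add_right, hβ, hxk, hck, hk₂]
    norm_num)
  rw [hm] at h₁
  simp only [inner_add_left, inner_add_right, inner_sub_left, inner_sub_right, hβ, hxk, hck, hk₂,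
    hxl, hcl, hl₂] at h₁ h₂ hm
  norm_num at h₁ h₂
  have h₃ := (abs_lt.mp h₂).1
  have hm₁ : m ^ 2 < 2 ^ 2 := by
    have : (m : ℝ) ^ 2 < 2 ^ 2 := by linarith
    exact_mod_cast this
  have : -2 < m := by nlinarith
  have : m < 2 := by nlinarith
  interval_cases m <;> norm_num at hm
  · linarith
  · linarith
  · linarith

theorem alpha_orthogonal (h : IsCoclosedFamily R I α β) {k l : ℕ} (hk : k ∈ I) (hl : l ∈ I)
    (hkl : k ≠ l) (hβ : ⟪β, β⟫ = 3 / 4) (hxk : ⟪β, α k⟫ = 1 / 4) (hxl : ⟪β, α l⟫ = 0)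
    (hk₂ : ⟪α k, α k⟫ = 3 / 4) (hl₂ : ⟪α l, α l⟫ = 1 / 4) : ⟪α k, α l⟫ = 0 := by
  have hck : ⟪α k, β⟫ = 1 / 4 := by rw [real_inner_comm, hxk]
  have hcl : ⟪α l, β⟫ = 0 := by rw [real_inner_comm, hxl]
  have h₁ := h.root.inner_sq_lt (h.add_mem hk) (h.add_mem hl)
    (fun he => hkl (h.inj k hk l hl 1 1 1 1 (by simp) (by simp) (by simp) (by simp)
      (by simpa using he)).1)
    (fun he => hkl (h.inj k hk l hl 1 1 (-1) (-1) (by simp) (by simp) (by simp) (by simp)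
      (by linear_combination (norm := module) (1 : ℝ) • he)).1)
  have h₂ := h.root.inner_sq_lt (h.add_mem hk) (h.sub_mem hl)
    (fun he => hkl (h.inj k hk l hl 1 1 1 (-1) (by simp) (by simp) (by simp) (by simp)
      (by linear_combination (norm := module) (1 : ℝ) • he)).1)
    (fun he => hkl (h.inj k hk l hl 1 1 (-1) 1 (by simp) (by simp) (by simp) (by simp)
      (by linear_combination (norm := module) (1 : ℝ) • he)).1)
  obtain ⟨m, hm⟩ := h.root.inner_eq_intCast (h.add_mem hk) (h.add_mem hl) (by
    simp only [inner_add_left, inner_add_right, hβ, hxk, hck, hk₂]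
    norm_num)
  rw [hm] at h₁
  simp only [inner_add_left, inner_add_right, inner_sub_left, inner_sub_right, hβ, hxk, hck, hk₂,
    hxl, hcl, hl₂] at h₁ h₂ hm
  norm_num at h₁ h₂
  have hm₁ : m ^ 2 < 2 := by exact_mod_cast h₁
  have : -2 < m := by nlinarith
  have : m < 2 := by nlinarith
  interval_cases m <;> norm_num at hm
  · nlinarith
  · nlinarith
  · linarith

/-- If `β = α p + α q + α r` with the Gram matrix found in type `B₃`, there is no fourth index. -/
theorem index_mem (h : IsCoclosedFamily R I α β) {p q r : ℕ} (hp : p ∈ I) (hq : q ∈ I)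
    (hr : r ∈ I) (hβ : ⟪β, β⟫ = 3 / 4) (hsum : β = α p + α q + α r)
    (hxp : ⟪β, α p⟫ = 1 / 4) (hxq : ⟪β, α q⟫ = 1 / 4) (hxr : ⟪β, α r⟫ = 1 / 4) {k : ℕ}
    (hk : k ∈ I) : k = p ∨ k = q ∨ k = r := by
  have hsq : ∀ {i}, i ∈ I → ⟪β, α i⟫ = 1 / 4 → ⟪α i, α i⟫ = 3 / 4 := by
    intro i hi hx
    rcases h.inner_cases hi with ⟨-, h' | h' | h'⟩ | ⟨h', -⟩ <;> linarith
  have hnew : ∀ {i}, i ∈ I → i ≠ p → i ≠ q → i ≠ r → ⟪β, α i⟫ = 0 ∧ ⟪α i, α i⟫ = 1 / 4 := by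
    intro i hi hip hiq hir
    rcases h.inner_cases hi with ⟨hx, -⟩ | ⟨hx, h'⟩
    · exfalso
      have hi₂ := hsq hi hx
      have e₁ := h.alpha_inner_alpha hp hi hip.symm hβ hxp hx (hsq hp hxp) hi₂
      have e₂ := h.alpha_inner_alpha hq hi hiq.symm hβ hxq hx (hsq hq hxq) hi₂
      have e₃ := h.alpha_inner_alpha hr hi hir.symm hβ hxr hx (hsq hr hxr) hi₂
      rw [hsum, inner_add_left, inner_add_left] at hx
      linarith
    · refine ⟨hx, ?_⟩
      rcases h' with h' | h' | h' | h' | h' <;> linarith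
  by_contra! hne
  obtain ⟨hkp, hkq, hkr⟩ := hne
  obtain ⟨hxk, hk₂⟩ := hnew hk hkp hkq hkr
  have hp₂ := hsq hp hxp
  have horth : ∀ {i}, i ∈ I → i ≠ k → ⟪β, α i⟫ = 1 / 4 → ⟪α k, α i⟫ = 0 := by
    intro i hi hik hx
    rw [real_inner_comm]
    exact h.alpha_orthogonal hi hk hik hβ hx hxk (hsq hi hx) hk₂
  have hkp' := horth hp hkp.symm hxp
  have hpk' : ⟪α p, α k⟫ = 0 := by rw [real_inner_comm, hkp']
  have hcp : ⟪α p, β⟫ = 1 / 4 := by rw [real_inner_comm, hxp]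
  have hck : ⟪α k, β⟫ = 0 := by rw [real_inner_comm, hxk]
  have h₁ : β - α p + (2 : ℝ) • α k ∈ R := by
    have := h.root.neg_mem (h.root.reflection_mem (h.add_mem hk) (h.add_mem hp) (c := 2) (by
      simp only [inner_add_left, inner_add_right, hβ, hxk, hxp, hkp', hk₂, hck]
      norm_num))
    convert this using 1
    module
  have h₂ : α p - α k ∈ R := by
    have := h.root.reflection_mem h₁ (h.add_mem hk) (c := 1) (by
      simp only [inner_add_left, inner_add_right, inner_sub_left, inner_sub_right,
        real_inner_smul_left, real_inner_smul_right, hβ, hxk, hxp, hkp', hpk', hk₂, hp₂, hck, hcp]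
      norm_num)
    convert this using 1
    module
  obtain ⟨m, hm, u, v, hu, hv, hmuv⟩ := h.coclosed _ h₁ _ h₂ k hk 1 1 (by simp) (by simp)
    (by module)
  have hm' : ⟪β, α m⟫ = 0 ∨ ⟪β, α m⟫ = 1 / 4 ∧ ⟪α k, α m⟫ = 0 := by
    by_cases hmp : ⟪β, α m⟫ = 1 / 4
    · refine Or.inr ⟨hmp, horth hm ?_ hmp⟩
      rintro rfl
      linarith
    · rcases h.inner_cases hm with h' | h'
      · exact absurd h'.1 hmp
      · exact Or.inl h'.1
  rcases hmuv with he | he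
  · have e₁ := congrArg (fun z => ⟪β, z⟫) he
    have e₂ := congrArg (fun z => ⟪α k, z⟫) he
    simp only [inner_sub_right, inner_add_right, real_inner_smul_right, hβ, hxp, hxk, hkp', hck,
      hk₂] at e₁ e₂
    rcases hm' with h' | ⟨h', h''⟩
    · rw [h'] at e₁
      rcases hv with rfl | rfl <;> norm_num at e₁
    · rw [h''] at e₂
      norm_num at e₂
  · have e₁ := congrArg (fun z => ⟪β, z⟫) he
    simp only [inner_sub_right, inner_add_right, real_inner_smul_right, hβ, hxp, hxk] at e₁
    rcases hu with rfl | rfl <;> rcases hv with rfl | rfl <;> rcases hm' with h' | ⟨h', -⟩ <;>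
      rw [h'] at e₁ <;> norm_num at e₁

theorem exists_triple (h : IsCoclosedFamily R I α β) {i j k : ℕ} (hi : i ∈ I) (hj : j ∈ I)
    (hk : k ∈ I) {s₁ t₁ s₂ t₂ s₃ t₃ : ℝ} (hs₁ : s₁ = 1 ∨ s₁ = -1) (ht₁ : t₁ = 1 ∨ t₁ = -1)
    (hs₂ : s₂ = 1 ∨ s₂ = -1) (ht₂ : t₂ = 1 ∨ t₂ = -1) (hs₃ : s₃ = 1 ∨ s₃ = -1)
    (ht₃ : t₃ = 1 ∨ t₃ = -1)
    (he : (s₁ • α i + t₁ • β) + (s₂ • α j + t₂ • β) = s₃ • α k + t₃ • β) :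
    ⟪β, β⟫ = 3 / 4 ∧ ⟪β, α i⟫ = 1 / 4 ∧ ⟪β, α j⟫ = 1 / 4 ∧ ⟪β, α k⟫ = 1 / 4 ∧
      β = α i + α j + α k := by
  have hin := congrArg (fun z => ⟪β, z⟫) he
  simp only [inner_add_right, real_inner_smul_right] at hin
  have hval : ∀ {m}, m ∈ I → ⟪β, α m⟫ = 0 ∨
      ⟪β, α m⟫ = 1 / 4 ∧ (⟪β, β⟫ = 3 / 4 ∨ ⟪β, β⟫ = 5 / 4) := by
    intro m hm
    have hq := fun hβ => h.inner_eq_zero_of_quarter hβ hm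
    rcases h.inner_cases hm with ⟨h', h'' | h'' | h''⟩ | ⟨h', -⟩
    · exact Or.inl (hq h''.1)
    · exact Or.inr ⟨h', Or.inl h''.1⟩
    · exact Or.inr ⟨h', Or.inr h''.1⟩
    · exact Or.inl h'
  have hpos : 0 < ⟪β, β⟫ := real_inner_self_pos.mpr (h.beta_ne_zero hi)
  have hbound : ∀ {s x : ℝ}, (s = 1 ∨ s = -1) → (x = 0 ∨ x = 1 / 4) →
      -(1 / 4) ≤ s * x ∧ s * x ≤ 1 / 4 := by
    rintro s x (rfl | rfl) (rfl | rfl) <;> norm_num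
  have hβ : ⟪β, β⟫ = 3 / 4 := by
    have hor : ⟪β, β⟫ = 3 / 4 ∨ ⟪β, β⟫ = 5 / 4 := by
      rcases hval hi with hxi | ⟨-, h'⟩
      · rcases hval hj with hxj | ⟨-, h'⟩
        · rcases hval hk with hxk | ⟨-, h'⟩
          · exfalso
            rw [hxi, hxj, hxk] at hin
            rcases ht₁ with rfl | rfl <;> rcases ht₂ with rfl | rfl <;>
              rcases ht₃ with rfl | rfl <;> linarith
          · exact h'
        · exact h'
      · exact h'
    refine hor.resolve_right fun h5 => ?_
    have b₁ := hbound hs₁ ((hval hi).imp_right And.left)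
    have b₂ := hbound hs₂ ((hval hj).imp_right And.left)
    have b₃ := hbound hs₃ ((hval hk).imp_right And.left)
    rw [h5] at hin
    rcases ht₁ with rfl | rfl <;> rcases ht₂ with rfl | rfl <;>
      rcases ht₃ with rfl | rfl <;> linarith
  have hi' := (hval hi).imp_right And.left
  have hj' := (hval hj).imp_right And.left
  have hk' := (hval hk).imp_right And.left
  rw [hβ] at hin
  rcases ht₁ with rfl | rfl <;> rcases ht₂ with rfl | rfl <;> rcases ht₃ with rfl | rfl <;>
    rcases hs₁ with rfl | rfl <;> rcases hs₂ with rfl | rfl <;> rcases hs₃ with rfl | rfl <;>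
    rcases hi' with hi' | hi' <;> rcases hj' with hj' | hj' <;> rcases hk' with hk' | hk' <;>
    rw [hi', hj', hk'] at hin <;> first
    | (exfalso; norm_num at hin; done)
    | exact ⟨hβ, hi', hj', hk', by linear_combination (norm := module) (1 : ℝ) • he⟩
    | exact ⟨hβ, hi', hj', hk', by linear_combination (norm := module) (-1 : ℝ) • he⟩

end IsCoclosedFamily

theorem statement0 {V : Type*} [NormedAddCommGroup V] [InnerProductSpace ℝ V]
    (R : Set V) (hR : IsRootSystem R)
    (hlen : ∀ r ∈ R, ⟪r, r⟫ = 1 ∨ ⟪r, r⟫ = 2)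
    (n : ℕ) (hn : 1 ≤ n) (β : V) (α : ℕ → V) (W : Set V)
    (hW : W = {v | ∃ i ∈ Finset.Icc 1 n, ∃ ε₁ ε₂ : ℝ,
      (ε₁ = 1 ∨ ε₁ = -1) ∧ (ε₂ = 1 ∨ ε₂ = -1) ∧ v = ε₁ • α i + ε₂ • β})
    (hWR : W ⊆ R)
    (hdist : ∀ i ∈ Finset.Icc 1 n, ∀ j ∈ Finset.Icc 1 n, ∀ ε₁ ε₂ η₁ η₂ : ℝ,
      (ε₁ = 1 ∨ ε₁ = -1) → (ε₂ = 1 ∨ ε₂ = -1) → (η₁ = 1 ∨ η₁ = -1) → (η₂ = 1 ∨ η₂ = -1) →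
      ε₁ • α i + ε₂ • β = η₁ • α j + η₂ • β → i = j ∧ ε₁ = η₁ ∧ ε₂ = η₂)
    (hclosed : IsClosedIn R (R \ W))
    (hpos : ∀ i ∈ Finset.Icc 1 n, 0 ≤ ⟪β, α i⟫)
    (hsum : ∃ w₁ ∈ W, ∃ w₂ ∈ W, ∃ w₃ ∈ W, w₁ + w₂ = w₃) :
    n = 3 ∧ β = α 1 + α 2 + α 3 ∧
      (∀ i ∈ Finset.Icc 1 3, ⟪β, α i⟫ = 1 / 4 ∧ ‖α i‖ ^ 2 = 3 / 4) ∧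
      ‖β‖ ^ 2 = 3 / 4 ∧
      (∀ i ∈ Finset.Icc 1 3, ∀ j ∈ Finset.Icc 1 3, i ≠ j → ⟪α i, α j⟫ = -(1 / 4)) := by
  have h : IsCoclosedFamily R (Finset.Icc 1 n) α β := by
    refine ⟨hR, hlen, ?_, hdist, ?_, hpos⟩
    · intro i hi s t hs ht
      apply hWR
      rw [hW]
      exact ⟨i, hi, s, t, hs, ht, rfl⟩
    · intro x hx y hy i hi s t hs ht hxy
      have hw : x + y ∈ W := by
        rw [hW]
        exact ⟨i, hi, s, t, hs, ht, hxy⟩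
      by_cases hxW : x ∈ W
      · rw [hW] at hxW
        obtain ⟨k, hk, u, v, hu, hv, he⟩ := hxW
        exact ⟨k, hk, u, v, hu, hv, Or.inl he⟩
      by_cases hyW : y ∈ W
      · rw [hW] at hyW
        obtain ⟨k, hk, u, v, hu, hv, he⟩ := hyW
        exact ⟨k, hk, u, v, hu, hv, Or.inr he⟩
      exact absurd hw (hclosed x ⟨hx, hxW⟩ y ⟨hy, hyW⟩ (hWR hw)).2
  obtain ⟨w₁, hw₁, w₂, hw₂, w₃, hw₃, he⟩ := hsum
  rw [hW] at hw₁ hw₂ hw₃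
  obtain ⟨i, hi, s₁, t₁, hs₁, ht₁, rfl⟩ := hw₁
  obtain ⟨j, hj, s₂, t₂, hs₂, ht₂, rfl⟩ := hw₂
  obtain ⟨k, hk, s₃, t₃, hs₃, ht₃, rfl⟩ := hw₃
  have hneg : ∀ {t : ℝ}, t = 1 ∨ t = -1 → -t = 1 ∨ -t = -1 := by
    rintro t (rfl | rfl) <;> norm_num
  have hij : i ≠ j := h.index_ne hi hk hs₁ ht₁ hs₂ ht₂ hs₃ ht₃ he
  have hik : k ≠ i := h.index_ne hk hj hs₃ ht₃ (hneg hs₁) (hneg ht₁) hs₂ ht₂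
    (by linear_combination (norm := module) (-1 : ℝ) • he)
  have hjk : k ≠ j := h.index_ne hk hi hs₃ ht₃ (hneg hs₂) (hneg ht₂) hs₁ ht₁
    (by linear_combination (norm := module) (-1 : ℝ) • he)
  obtain ⟨hβ, hxi, hxj, hxk, hsum⟩ := h.exists_triple hi hj hk hs₁ ht₁ hs₂ ht₂ hs₃ ht₃ he
  have hall : ∀ {m}, m ∈ Finset.Icc 1 n → m = i ∨ m = j ∨ m = k := fun hm =>
    h.index_mem hi hj hk hβ hsum hxi hxj hxk hm
  have hI : Finset.Icc 1 n = {i, j, k} := by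
    ext m
    simp only [Finset.mem_insert, Finset.mem_singleton]
    refine ⟨hall, ?_⟩
    rintro (rfl | rfl | rfl) <;> assumption
  have hn3 : n = 3 := by
    have hc := congrArg Finset.card hI
    rw [Finset.card_eq_three.mpr ⟨i, j, k, hij, hik.symm, hjk.symm, rfl⟩] at hc
    simpa using hc
  subst hn3
  have hx : ∀ m ∈ Finset.Icc 1 3, ⟪β, α m⟫ = 1 / 4 := by
    intro m hm
    rcases hall hm with rfl | rfl | rfl <;> assumption
  have hsq : ∀ m ∈ Finset.Icc 1 3, ⟪α m, α m⟫ = 3 / 4 := by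
    intro m hm
    have := hx m hm
    rcases h.inner_cases hm with ⟨-, h' | h' | h'⟩ | ⟨h', -⟩ <;> linarith
  refine ⟨rfl, ?_, fun m hm => ⟨hx m hm, ?_⟩, ?_, fun l hl m hm hlm =>
    h.alpha_inner_alpha hl hm hlm hβ (hx l hl) (hx m hm) (hsq l hl) (hsq m hm)⟩
  · have h₁ : ∑ m ∈ Finset.Icc 1 3, α m = α i + α j + α k := by
      rw [hI, Finset.sum_insert (by simp [hij, hik.symm]), Finset.sum_insert (by simp [hjk.symm]),
        Finset.sum_singleton, add_assoc]
    have h₂ : ∑ m ∈ Finset.Icc 1 3, α m = α 1 + α 2 + α 3 := by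
      simp [Finset.sum_Icc_succ_top]
    rw [hsum, ← h₁, h₂]
  · rw [← real_inner_self_eq_norm_sq, hsq m hm]
  · rw [← real_inner_self_eq_norm_sq, hβ]
end

section
/- Let V be a real inner product space and let R ⊆ V be a root system all of whose elements have square length 1 or 2. Let n ≥ 3 and let β, α₁, …, αₙ ∈ V be such that: (i) the 4n vectors ε·αᵢ + ε′·β (1 ≤ i ≤ n, ε, ε′ ∈ {1, −1}) are pairwise distinct and all lie in R; denote by W the set of these 4n vectors and set S := R \ W; (ii) S is closed; (iii) ⟨β, αᵢ⟩ ≥ 0 for all i; (iv) β = α₁ + α₂ + α₃ and ⟨β, αᵢ⟩ = 1/4 for i = 1, 2, 3. Then n = 3. -/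
open scoped RealInnerProductSpace

theorem statement1 {V : Type*} [NormedAddCommGroup V] [InnerProductSpace ℝ V]
    (R : Set V) (hR : IsRootSystem R)
    (hlen : ∀ r ∈ R, ⟪r, r⟫ = 1 ∨ ⟪r, r⟫ = 2)
    (n : ℕ) (hn : 3 ≤ n) (β : V) (α : ℕ → V) (W : Set V)
    (hW : W = {v | ∃ i ∈ Finset.Icc 1 n, ∃ ε₁ ε₂ : ℝ,
      (ε₁ = 1 ∨ ε₁ = -1) ∧ (ε₂ = 1 ∨ ε₂ = -1) ∧ v = ε₁ • α i + ε₂ • β})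
    (hWR : W ⊆ R)
    (hdist : ∀ i ∈ Finset.Icc 1 n, ∀ j ∈ Finset.Icc 1 n, ∀ ε₁ ε₂ η₁ η₂ : ℝ,
      (ε₁ = 1 ∨ ε₁ = -1) → (ε₂ = 1 ∨ ε₂ = -1) → (η₁ = 1 ∨ η₁ = -1) → (η₂ = 1 ∨ η₂ = -1) →
      ε₁ • α i + ε₂ • β = η₁ • α j + η₂ • β → i = j ∧ ε₁ = η₁ ∧ ε₂ = η₂)
    (hclosed : IsClosedIn R (R \ W))
    (hpos : ∀ i ∈ Finset.Icc 1 n, 0 ≤ ⟪β, α i⟫)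
    (hβ : β = α 1 + α 2 + α 3)
    (hq : ∀ i ∈ Finset.Icc 1 3, ⟪β, α i⟫ = 1 / 4) :
    n = 3 := by
  obtain ⟨-, -, -, hcartan, hrefl⟩ := hR
  have mem_W : ∀ i ∈ Finset.Icc 1 n, ∀ ε₁ ε₂ : ℝ, (ε₁ = 1 ∨ ε₁ = -1) → (ε₂ = 1 ∨ ε₂ = -1) →
      ε₁ • α i + ε₂ • β ∈ W := by
    intro i hi ε₁ ε₂ h₁ h₂
    rw [hW]
    exact ⟨i, hi, ε₁, ε₂, h₁, h₂, rfl⟩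
  have add_mem : ∀ i ∈ Finset.Icc 1 n, α i + β ∈ R := fun i hi ↦ by
    simpa using hWR (mem_W i hi 1 1 (by simp) (by simp))
  have sub_mem_W : ∀ i ∈ Finset.Icc 1 n, β - α i ∈ W := fun i hi ↦ by
    have h := mem_W i hi (-1) 1 (by simp) (by simp)
    rwa [neg_one_smul, one_smul, neg_add_eq_sub] at h
  have sub_mem : ∀ i ∈ Finset.Icc 1 n, β - α i ∈ R := fun i hi ↦ hWR (sub_mem_W i hi)
  have hββ : ⟪β, β⟫ = 3 / 4 := by
    nth_rewrite 2 [hβ]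
    rw [inner_add_right, inner_add_right, hq 1 (by simp), hq 2 (by simp), hq 3 (by simp)]
    norm_num
  have norm_add : ∀ i, ⟪α i + β, α i + β⟫ = ⟪α i, α i⟫ + 2 * ⟪β, α i⟫ + 3 / 4 := fun i ↦ by
    rw [real_inner_add_add_self, hββ, real_inner_comm β (α i)]
  have norm_sub : ∀ i, ⟪β - α i, β - α i⟫ = ⟪α i, α i⟫ - 2 * ⟪β, α i⟫ + 3 / 4 := fun i ↦ by
    rw [real_inner_sub_sub_self, hββ]
    ring
  have inner_cases : ∀ i ∈ Finset.Icc 1 n,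
      (⟪β, α i⟫ = 0 ∧ (⟪α i, α i⟫ = 1 / 4 ∨ ⟪α i, α i⟫ = 5 / 4)) ∨
      (⟪β, α i⟫ = 1 / 4 ∧ ⟪α i, α i⟫ = 3 / 4) := by
    intro i hi
    have h₀ := hpos i hi
    have h₁ := hlen _ (add_mem i hi)
    have h₂ := hlen _ (sub_mem i hi)
    rw [norm_add] at h₁
    rw [norm_sub] at h₂
    rcases h₁ with h₁ | h₁ <;> rcases h₂ with h₂ | h₂
    · exact .inl ⟨by linarith, .inl (by linarith)⟩
    · linarith
    · exact .inr ⟨by linarith, by linarith⟩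
    · exact .inl ⟨by linarith, .inr (by linarith)⟩
  have not_mem_W : ∀ v, ⟪β, v⟫ = 1 / 4 → v ∉ W := by
    intro v hv hvW
    rw [hW] at hvW
    obtain ⟨i, hi, ε₁, ε₂, h₁, h₂, rfl⟩ := hvW
    rw [inner_add_right, inner_smul_right, inner_smul_right, hββ] at hv
    rcases inner_cases i hi with ⟨h, -⟩ | ⟨h, -⟩ <;> rw [h] at hv <;>
      rcases h₁ with rfl | rfl <;> rcases h₂ with rfl | rfl <;> norm_num at hv
  by_contra hne
  have h₄ : 4 ∈ Finset.Icc 1 n := Finset.mem_Icc.2 ⟨by norm_num, by omega⟩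
  have small : ∀ i ∈ Finset.Icc 1 3, i ∈ Finset.Icc 1 n := fun i hi ↦ by
    rw [Finset.mem_Icc] at hi ⊢
    omega
  have norm_small : ∀ i ∈ Finset.Icc 1 3, ⟪α i, α i⟫ = 3 / 4 := by
    intro i hi
    rcases inner_cases i (small i hi) with ⟨h, -⟩ | ⟨-, h⟩
    · linarith [hq i hi]
    · exact h
  have integrality : ∀ i ∈ Finset.Icc 1 3, ∃ k : ℤ, ⟪α i, α 4⟫ = k - ⟪β, α 4⟫ := by
    intro i hi
    obtain ⟨k, hk⟩ := hcartan _ (add_mem i (small i hi)) _ (add_mem 4 h₄)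
    rw [norm_add, norm_small i hi, hq i hi, inner_add_left, inner_add_right, inner_add_right, hββ, real_inner_comm β (α i),
      hq i hi] at hk
    refine ⟨k - 1, ?_⟩
    push_cast
    linarith
  have cauchy : ∀ i ∈ Finset.Icc 1 3, ⟪α i, α 4⟫ * ⟪α i, α 4⟫ ≤ 3 / 4 * ⟪α 4, α 4⟫ := by
    intro i hi
    rw [← norm_small i hi]
    exact real_inner_mul_inner_self_le _ _
  have hsum : ⟪α 1, α 4⟫ + ⟪α 2, α 4⟫ + ⟪α 3, α 4⟫ = ⟪β, α 4⟫ := by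
    rw [hβ, inner_add_left, inner_add_left]
  rcases inner_cases 4 h₄ with ⟨hb, hγ | hγ⟩ | ⟨hb, hγ⟩
  · have orth : ∀ i ∈ Finset.Icc 1 3, ⟪α i, α 4⟫ = 0 := by
      intro i hi
      obtain ⟨k, hk⟩ := integrality i hi
      have hc := cauchy i hi
      rw [hk, hb, hγ, sub_zero] at hc
      have h₁ : (k : ℝ) < 1 := by nlinarith
      have h₂ : (-1 : ℝ) < k := by nlinarith
      have h₃ : k = 0 := by
        have : k < 1 := by exact_mod_cast h₁
        have : -1 < k := by exact_mod_cast h₂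
        omega
      rw [hk, hb, h₃]
      norm_num
    have reflect : ∀ i ∈ Finset.Icc 1 3, ∀ r ∈ R, ⟪β - α i, r⟫ = 1 / 2 →
        r - (β - α i) ∈ R := by
      intro i hi r hr h
      have h' := hrefl _ (sub_mem i (small i hi)) r hr
      rw [h, norm_sub, norm_small i hi, hq i hi] at h'
      norm_num at h'
      exact h'
    have mem₁ : α 1 + α 4 ∈ R \ W := by
      refine ⟨?_, not_mem_W _ ?_⟩
      · have h := reflect 1 (by simp) _ (add_mem 4 h₄) (by
          rw [inner_sub_left, inner_add_right, inner_add_right, hββ, hb, orth 1 (by simp),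
            real_inner_comm β (α 1), hq 1 (by simp)]
          norm_num)
        convert h using 1
        abel
      · rw [inner_add_right, hb, hq 1 (by simp), add_zero]
    have mem₂ : α 2 - α 4 ∈ R \ W := by
      refine ⟨?_, not_mem_W _ ?_⟩
      · have h := reflect 2 (by simp) _ (sub_mem 4 h₄) (by
          rw [inner_sub_left, inner_sub_right, inner_sub_right, hββ, hb, orth 2 (by simp),
            real_inner_comm β (α 2), hq 2 (by simp)]
          norm_num)
        convert h using 1
        abel
      · rw [inner_sub_right, hb, hq 2 (by simp), sub_zero]
    have heq : α 1 + α 4 + (α 2 - α 4) = β - α 3 := by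
      rw [hβ]
      abel
    have h₃ := small 3 (by simp)
    have h := hclosed _ mem₁ _ mem₂ (heq ▸ sub_mem 3 h₃)
    rw [heq] at h
    exact h.2 (sub_mem_W 3 h₃)
  · obtain ⟨k, hk⟩ := integrality 1 (by simp)
    obtain ⟨m, hm⟩ := hcartan _ (add_mem 4 h₄) _ (sub_mem 1 (small 1 (by simp)))
    rw [norm_add, hγ, hb, inner_sub_right, inner_add_left, inner_add_left, hββ,
      real_inner_comm β (α 4), hb, real_inner_comm (α 1) (α 4), hk, hb, hq 1 (by simp)] at hm
    have h : ((2 * m + 2 * k : ℤ) : ℝ) = (1 : ℤ) := by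
      push_cast
      linarith
    have h' := Int.cast_injective h
    omega
  · have not_eq : ∀ i ∈ Finset.Icc 1 3, ⟪α i, α 4⟫ ≠ 3 / 4 := by
      intro i hi h
      have h₀ : α i - α 4 = 0 := by
        rw [← inner_self_eq_zero (𝕜 := ℝ), real_inner_sub_sub_self, norm_small i hi, hγ, h]
        norm_num
      have h₁ := hdist i (small i hi) 4 h₄ 1 1 1 1 (by simp) (by simp) (by simp) (by simp)
        (by rw [sub_eq_zero.1 h₀])
      rw [h₁.1] at hi
      simp at hi
    have neg : ∀ i ∈ Finset.Icc 1 3, ⟪α i, α 4⟫ < 0 := by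
      intro i hi
      obtain ⟨k, hk⟩ := integrality i hi
      have hc := cauchy i hi
      have hn := not_eq i hi
      rw [hk, hb, hγ] at hc
      rw [hk, hb] at hn ⊢
      have h₁ : (k : ℝ) < 2 := by nlinarith
      have h₂ : k < 2 := by exact_mod_cast h₁
      have h₃ : k ≠ 1 := by
        rintro rfl
        norm_num at hn
      have h₄ : (k : ℝ) ≤ 0 := by exact_mod_cast (by omega : k ≤ 0)
      linarith
    linarith [neg 1 (by simp), neg 2 (by simp), neg 3 (by simp)]
end

section
/- Let V be a real inner product space and let R ⊆ V be a root system all of whose elements have square length 1 or 2. Let β, α₁, α₂, α₃ ∈ V be such that: (i) the 12 vectors ε·αᵢ + ε′·β (1 ≤ i ≤ 3, ε, ε′ ∈ {1, −1}) are pairwise distinct and all lie in R; denote by W the set of these 12 vectors and set S := R \ W; (ii) S is closed; (iii) β = α₁ + α₂ + α₃ and ⟨β, αᵢ⟩ = 1/4 for i = 1, 2, 3. Define γᵢ := β − αᵢ for i = 1, 2, 3. Then: ⟨γᵢ, γⱼ⟩ = 1 if i = j and 0 if i ≠ j; W = {±γ₁, ±γ₂, ±γ₃, ±(γ₁+γ₂),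 ±(γ₁+γ₃), ±(γ₂+γ₃)}; γᵢ − γⱼ ∈ S for all i ≠ j; and consequently R contains all eighteen vectors ±γᵢ (1 ≤ i ≤ 3) and ±γᵢ ± γⱼ (i < j), i.e. R contains a root system of type B₃. -/
open scoped RealInnerProductSpace

theorem statement2 {V : Type*} [NormedAddCommGroup V] [InnerProductSpace ℝ V]
    (R : Set V) (hR : IsRootSystem R)
    (hlen : ∀ r ∈ R, ⟪r, r⟫ = 1 ∨ ⟪r, r⟫ = 2)
    (β : V) (α : Fin 3 → V) (W : Set V)
    (hW : W = {v | ∃ i : Fin 3, ∃ ε₁ ε₂ : ℝ,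
      (ε₁ = 1 ∨ ε₁ = -1) ∧ (ε₂ = 1 ∨ ε₂ = -1) ∧ v = ε₁ • α i + ε₂ • β})
    (hWR : W ⊆ R)
    (hdist : ∀ i j : Fin 3, ∀ ε₁ ε₂ η₁ η₂ : ℝ,
      (ε₁ = 1 ∨ ε₁ = -1) → (ε₂ = 1 ∨ ε₂ = -1) → (η₁ = 1 ∨ η₁ = -1) → (η₂ = 1 ∨ η₂ = -1) →
      ε₁ • α i + ε₂ • β = η₁ • α j + η₂ • β → i = j ∧ ε₁ = η₁ ∧ ε₂ = η₂)
    (hclosed : IsClosedIn R (R \ W))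
    (hβ : β = α 0 + α 1 + α 2)
    (hq : ∀ i, ⟪β, α i⟫ = 1 / 4)
    (γ : Fin 3 → V) (hγ : ∀ i, γ i = β - α i) :
    (∀ i j, ⟪γ i, γ j⟫ = if i = j then 1 else 0) ∧
    W = {v | ∃ i, v = γ i ∨ v = -(γ i)} ∪
        {v | ∃ i j, i < j ∧ (v = γ i + γ j ∨ v = -(γ i + γ j))} ∧
    (∀ i j, i ≠ j → γ i - γ j ∈ R \ W) ∧
    (∀ i, γ i ∈ R ∧ -(γ i) ∈ R) ∧
    (∀ i j, i < j →
      γ i + γ j ∈ R ∧ γ i - γ j ∈ R ∧ -(γ i) + γ j ∈ R ∧ -(γ i) - γ j ∈ R) := by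
  have hβα : ∀ i, ⟪α i, β⟫ = 1 / 4 := fun i => by rw [real_inner_comm, hq]
  have hββ : ⟪β, β⟫ = 3 / 4 := by
    calc ⟪β, β⟫ = ⟪β, α 0 + α 1 + α 2⟫ := by rw [← hβ]
      _ = 3 / 4 := by rw [inner_add_right, inner_add_right, hq, hq, hq]; norm_num
  have hmem : ∀ i, ∀ ε₁ ε₂ : ℝ, (ε₁ = 1 ∨ ε₁ = -1) → (ε₂ = 1 ∨ ε₂ = -1) →
      ε₁ • α i + ε₂ • β ∈ W := fun i ε₁ ε₂ h₁ h₂ => by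
    rw [hW]; exact ⟨i, ε₁, ε₂, h₁, h₂, rfl⟩
  have hγW : ∀ i, γ i ∈ W := fun i => by
    convert hmem i (-1) 1 (by simp) (by simp) using 1
    rw [hγ]; module
  have hγW' : ∀ i, -γ i ∈ W := fun i => by
    convert hmem i 1 (-1) (by simp) (by simp) using 1
    rw [hγ]; module
  have hαW : ∀ i, α i + β ∈ W := fun i => by
    convert hmem i 1 1 (by simp) (by simp) using 1
    module
  have hαW' : ∀ i, -(α i + β) ∈ W := fun i => by
    convert hmem i (-1) (-1) (by simp) (by simp) using 1
    module
  have hαα : ∀ i, ⟪α i, α i⟫ = 3 / 4 := fun i => by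
    have h₁ := hlen _ (hWR (hγW i))
    have h₂ := hlen _ (hWR (hαW i))
    simp only [hγ, inner_sub_left, inner_sub_right, inner_add_left, inner_add_right,
      hββ, hq, hβα] at h₁ h₂
    rcases h₁ with h₁ | h₁ <;> rcases h₂ with h₂ | h₂ <;> linarith
  have hγγ : ∀ i, ⟪γ i, γ i⟫ = 1 := fun i => by
    simp only [hγ, inner_sub_left, inner_sub_right, hββ, hq, hβα, hαα]; norm_num
  have hsum : ∀ i j, i ≠ j → ∃ k, γ i + γ j = α k + β := fun i j hij => by
    have h₀₁ : γ 0 + γ 1 = α 2 + β := by rw [hγ, hγ, hβ]; abel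
    have h₀₂ : γ 0 + γ 2 = α 1 + β := by rw [hγ, hγ, hβ]; abel
    have h₁₂ : γ 1 + γ 2 = α 0 + β := by rw [hγ, hγ, hβ]; abel
    fin_cases i <;> fin_cases j <;> first
      | exact absurd rfl hij
      | exact ⟨_, h₀₁⟩
      | exact ⟨_, h₀₂⟩
      | exact ⟨_, h₁₂⟩
      | exact ⟨_, (add_comm _ _).trans h₀₁⟩
      | exact ⟨_, (add_comm _ _).trans h₀₂⟩
      | exact ⟨_, (add_comm _ _).trans h₁₂⟩
  have hsum' : ∀ k, ∃ i j, i < j ∧ α k + β = γ i + γ j := fun k => by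
    fin_cases k
    · exact ⟨1, 2, by decide, by simp only [hγ, hβ, Fin.zero_eta]; abel⟩
    · exact ⟨0, 2, by decide, by simp only [hγ, hβ, Fin.mk_one]; abel⟩
    · exact ⟨0, 1, by decide, by simp only [hγ, hβ, Fin.reduceFinMk]; abel⟩
  have horth : ∀ i j, i ≠ j → ⟪γ i, γ j⟫ = 0 := fun i j hij => by
    obtain ⟨k, hk⟩ := hsum i j hij
    have h : ⟪γ i + γ j, γ i + γ j⟫ = 2 := by
      rw [hk]
      simp only [inner_add_left, inner_add_right, hββ, hq, hβα, hαα]; norm_num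
    rw [real_inner_add_add_self, hγγ, hγγ] at h
    linarith
  have hadd : ∀ i j, i ≠ j → γ i + γ j ∈ W ∧ -(γ i + γ j) ∈ W := fun i j hij => by
    obtain ⟨k, hk⟩ := hsum i j hij
    rw [hk]; exact ⟨hαW k, hαW' k⟩
  have hsub : ∀ i j, i ≠ j → γ i - γ j ∈ R := fun i j hij => by
    convert hR.2.2.2.2 _ (hWR (hγW j)) _ (hWR (hadd i j hij).1) using 1
    rw [inner_add_right, hγγ, horth j i hij.symm]
    module
  refine ⟨fun i j => ?_, ?_, fun i j hij => ⟨hsub i j hij, fun h => ?_⟩,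
    fun i => ⟨hWR (hγW i), hWR (hγW' i)⟩, fun i j hij => ⟨hWR (hadd i j hij.ne).1,
      hsub i j hij.ne, ?_, ?_⟩⟩
  · split_ifs with h
    · rw [h, hγγ]
    · exact horth i j h
  · apply Set.Subset.antisymm
    · rw [hW]
      rintro v ⟨k, ε₁, ε₂, rfl | rfl, rfl | rfl, rfl⟩
      · obtain ⟨i, j, hij, h⟩ := hsum' k
        exact Or.inr ⟨i, j, hij, Or.inl (by rw [← h]; module)⟩
      · exact Or.inl ⟨k, Or.inr (by rw [hγ]; module)⟩
      · exact Or.inl ⟨k, Or.inl (by rw [hγ]; module)⟩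
      · obtain ⟨i, j, hij, h⟩ := hsum' k
        exact Or.inr ⟨i, j, hij, Or.inr (by rw [← h]; module)⟩
    · rintro v (⟨i, rfl | rfl⟩ | ⟨i, j, hij, rfl | rfl⟩)
      exacts [hγW i, hγW' i, (hadd i j hij.ne).1, (hadd i j hij.ne).2]
  · -- `γ i - γ j` is orthogonal to `β`, whereas no element of `W` is.
    rw [hW] at h
    obtain ⟨k, ε₁, ε₂, h₁, h₂, h⟩ := h
    have h' := congrArg (fun v => ⟪v, β⟫) h
    simp only [hγ, inner_sub_left, inner_add_left, real_inner_smul_left, hββ, hβα] at h'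
    rcases h₁ with rfl | rfl <;> rcases h₂ with rfl | rfl <;> norm_num at h'
  · convert hsub j i hij.ne' using 1
    abel
  · convert hWR (hadd i j hij.ne).2 using 1
    abel
end

section
/- Let V be a real inner product space and let R ⊆ V be a root system. Suppose β, α₁, α₂ ∈ V are such that ε·α₁ + ε′·β ∈ R and ε·α₂ + ε′·β ∈ R for all ε, ε′ ∈ {1, −1}. Then 3β ≠ α₁, 3β ≠ −α₁, and β ∉ {2α₁ + α₂, 2α₁ − α₂, −2α₁ + α₂, −2α₁ − α₂}. -/
open scoped RealInnerProductSpace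

/-- A root system does not contain both a vector and its double. -/
theorem IsRootSystem.two_smul_notMem_s6 {V : Type*} [NormedAddCommGroup V] [InnerProductSpace ℝ V]
    {R : Set V} (hR : IsRootSystem R) {x : V} (hx : x ∈ R) : (2 : ℝ) • x ∉ R := by
  obtain ⟨-, h0, hmul, -, -⟩ := hR
  intro h2
  have hx0 : x ≠ 0 := fun h => h0 (h ▸ hx)
  rcases hmul x hx 2 h2 with h | h
  · exact hx0 (by simpa [two_smul] using h)
  · have h3 : (3 : ℝ) • x = 0 := by
      rw [show (3 : ℝ) • x = (2 : ℝ) • x + x by module, h, neg_add_cancel]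
    exact hx0 ((smul_eq_zero.mp h3).resolve_left (by norm_num))

theorem statement6 {V : Type*} [NormedAddCommGroup V] [InnerProductSpace ℝ V]
    (R : Set V) (hR : IsRootSystem R)
    (β α₁ α₂ : V)
    (h : ∀ ε₁ ε₂ : ℝ, (ε₁ = 1 ∨ ε₁ = -1) → (ε₂ = 1 ∨ ε₂ = -1) →
      ε₁ • α₁ + ε₂ • β ∈ R ∧ ε₁ • α₂ + ε₂ • β ∈ R) :
    (3 : ℝ) • β ≠ α₁ ∧ (3 : ℝ) • β ≠ -α₁ ∧
    β ≠ (2 : ℝ) • α₁ + α₂ ∧ β ≠ (2 : ℝ) • α₁ - α₂ ∧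
    β ≠ -((2 : ℝ) • α₁) + α₂ ∧ β ≠ -((2 : ℝ) • α₁) - α₂ := by
  have hpp₁ := (h 1 1 (.inl rfl) (.inl rfl)).1
  have hmp₁ := (h (-1) 1 (.inr rfl) (.inl rfl)).1
  have hpp₂ := (h 1 1 (.inl rfl) (.inl rfl)).2
  have hmp₂ := (h (-1) 1 (.inr rfl) (.inl rfl)).2
  have hpm₁ := (h 1 (-1) (.inl rfl) (.inr rfl)).1
  have double {x y : V} (hx : x ∈ R) (hy : y ∈ R) : y ≠ (2 : ℝ) • x :=
    fun hxy => hR.two_smul_notMem_s6 hx (hxy ▸ hy)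
  refine ⟨fun e => ?_, fun e => ?_, fun e => ?_, fun e => ?_, fun e => ?_, fun e => ?_⟩
  · refine double hpm₁ hpp₁ ?_
    subst e
    module
  · refine double hpp₁ hpm₁ ?_
    obtain rfl : α₁ = -((3 : ℝ) • β) := by rw [e, neg_neg]
    module
  · refine double hmp₁ hpp₂ ?_
    subst e
    module
  · refine double hmp₁ hmp₂ ?_
    subst e
    module
  · refine double hpp₁ hpp₂ ?_
    subst e
    module
  · refine double hpp₁ hmp₂ ?_
    subst e
    module
end

section
/- Let V be a real inner product space and let R ⊆ V be a root system all of whose elements have square length 1 or 2. Then there do not exist β, α₁, α₂, α₃ ∈ V with β ≠ 0, ⟨β, αᵢ⟩ ≥ 0 for i = 1, 2, 3, 3β = σ₁α₁ + σ₂α₂ + σ₃α₃ for some signs σ₁, σ₂, σ₃ ∈ {1, −1}, and ε·αᵢ + ε′·β ∈ R for all i ∈ {1,2,3} and all ε, ε′ ∈ {1, −1}. -/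
open scoped RealInnerProductSpace

/-- If both `a + b` and `a - b` are roots, all roots have square length 1 or 2 and `⟪b, a⟫ ≥ 0`,
then either `a ⟂ b`, or `a + b` is long, `a - b` is short and `4 * ⟪b, b⟫` is an integer. -/
lemma IsRootSystem.inner_eq_zero_or_of_add_sub_mem {V : Type*} [NormedAddCommGroup V]
    [InnerProductSpace ℝ V] {R : Set V} (hR : IsRootSystem R)
    (hlen : ∀ r ∈ R, ⟪r, r⟫ = 1 ∨ ⟪r, r⟫ = 2) {a b : V} (hadd : a + b ∈ R) (hsub : a - b ∈ R)
    (hnonneg : 0 ≤ ⟪b, a⟫) :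
    ⟪b, a⟫ = 0 ∨ ⟪b, a⟫ = 1 / 4 ∧ ⟪a, a⟫ + ⟪b, b⟫ = 3 / 2 ∧ ∃ n : ℤ, 4 * ⟪b, b⟫ = n := by
  obtain ⟨k, hk⟩ := hR.2.2.2.1 _ hsub _ hadd
  have hp := hlen _ hadd
  have hm := hlen _ hsub
  simp only [inner_add_left, inner_add_right, inner_sub_left, inner_sub_right,
    real_inner_comm b a] at hk hp hm
  rcases hp with hp | hp <;> rcases hm with hm | hm
  · left; linarith
  · left; linarith
  · right
    refine ⟨by linarith, by linarith, 3 - k, ?_⟩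
    rw [hm, div_one] at hk
    push_cast
    linarith
  · left; linarith

theorem statement7 {V : Type*} [NormedAddCommGroup V] [InnerProductSpace ℝ V]
    (R : Set V) (hR : IsRootSystem R)
    (hlen : ∀ r ∈ R, ⟪r, r⟫ = 1 ∨ ⟪r, r⟫ = 2) :
    ¬ ∃ (β : V) (α : Fin 3 → V) (σ : Fin 3 → ℝ),
      β ≠ 0 ∧ (∀ i, 0 ≤ ⟪β, α i⟫) ∧ (∀ i, σ i = 1 ∨ σ i = -1) ∧
      (3 : ℝ) • β = σ 0 • α 0 + σ 1 • α 1 + σ 2 • α 2 ∧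
      (∀ i, ∀ ε₁ ε₂ : ℝ, (ε₁ = 1 ∨ ε₁ = -1) → (ε₂ = 1 ∨ ε₂ = -1) →
        ε₁ • α i + ε₂ • β ∈ R) := by
  rintro ⟨β, α, σ, hβ, hnonneg, hσ, hsum, hroot⟩
  have hadd : ∀ i, α i + β ∈ R := fun i => by
    simpa using hroot i 1 1 (Or.inl rfl) (Or.inl rfl)
  have hsub : ∀ i, α i - β ∈ R := fun i => by
    simpa [sub_eq_add_neg] using hroot i 1 (-1) (Or.inl rfl) (Or.inr rfl)
  have hcase := fun i =>
    hR.inner_eq_zero_or_of_add_sub_mem hlen (hadd i) (hsub i) (hnonneg i)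
  have hpos : 0 < ⟪β, β⟫ := real_inner_self_pos.mpr hβ
  have hinner : 3 * ⟪β, β⟫ = σ 0 * ⟪β, α 0⟫ + σ 1 * ⟪β, α 1⟫ + σ 2 * ⟪β, α 2⟫ := by
    simpa only [inner_add_right, inner_smul_right] using congrArg (fun v => ⟪β, v⟫) hsum
  have hle : ∀ i, σ i * ⟪β, α i⟫ ≤ 1 / 4 := fun i => by
    rcases hσ i with h | h <;> rcases hcase i with h' | ⟨h', -⟩ <;> rw [h, h'] <;> norm_num
  have hint : ∃ n : ℤ, 4 * ⟪β, β⟫ = n := by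
    by_contra hne
    have hzero : ∀ i, ⟪β, α i⟫ = 0 := fun i => (hcase i).resolve_right fun h => hne h.2.2
    simp only [hzero, mul_zero, add_zero] at hinner
    linarith
  have hββ : ⟪β, β⟫ = 1 / 4 := by
    obtain ⟨n, hn⟩ := hint
    have hn0 : (0 : ℝ) < n := by linarith
    have hn1 : (1 : ℝ) ≤ n := by exact_mod_cast (Int.cast_pos.mp hn0 : 0 < n)
    linarith [hle 0, hle 1, hle 2]
  have hmax : ∀ i, σ i * ⟪β, α i⟫ = 1 / 4 := by
    have h0 := hle 0
    have h1 := hle 1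
    have h2 := hle 2
    intro i
    fin_cases i <;> simp only [Fin.zero_eta, Fin.mk_one, Fin.reduceFinMk] <;> linarith
  have hall : ∀ i, σ i = 1 ∧ ⟪β, α i⟫ = 1 / 4 ∧ ⟪α i, α i⟫ = 5 / 4 := fun i => by
    have h := hmax i
    rcases hcase i with h' | ⟨h', h'', -⟩
    · rw [h'] at h; norm_num at h
    · refine ⟨?_, h', by linarith⟩
      rw [h'] at h
      linarith
  have hα : α 0 + α 1 = (3 : ℝ) • β - α 2 := by
    rw [hsum, (hall 0).1, (hall 1).1, (hall 2).1]
    simp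
  have h01 : ⟪α 0, α 1⟫ = -1 / 4 := by
    have h := congrArg (fun v => ⟪v, v⟫) hα
    simp only [inner_add_left, inner_add_right, inner_sub_left, inner_sub_right,
      real_inner_smul_left, real_inner_smul_right, real_inner_comm β (α 2),
      real_inner_comm (α 0) (α 1), (hall _).2.1, (hall _).2.2, hββ] at h
    linarith [real_inner_comm (α 0) (α 1), real_inner_comm β (α 2), (hall 2).2.1]
  obtain ⟨k, hk⟩ := hR.2.2.2.1 _ (hadd 0) _ (hadd 1)
  simp only [inner_add_left, inner_add_right, real_inner_comm β, (hall _).2.1, (hall _).2.2,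
    hββ, h01] at hk
  norm_num at hk
  have h2k : (1 : ℝ) = 2 * k := by linarith
  have h2k' : (1 : ℤ) = 2 * k := by exact_mod_cast h2k
  omega
end

section
/- Let V be a real inner product space and let R ⊆ V be a root system all of whose elements have square length 1 or 2. Suppose β, α₁, α₂, α₃ ∈ V satisfy β = α₁ + α₂ + α₃, ⟨β, αᵢ⟩ = 1/4 for i = 1, 2, 3, and ε·αᵢ + ε′·β ∈ R for all i ∈ {1,2,3} and all ε, ε′ ∈ {1, −1}. Then ‖β‖² = 3/4, ‖αᵢ‖² = 3/4 for each i, ⟨αᵢ, αⱼ⟩ = −1/4 for all i ≠ j, αᵢ − αⱼ ∈ R for all i ≠ j, and the vectors γᵢ := β − αᵢ satisfy ⟨γᵢ, γⱼ⟩ = 1 if i = j and 0 if i ≠ j. -/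
open scoped RealInnerProductSpace

theorem statement10 {V : Type*} [NormedAddCommGroup V] [InnerProductSpace ℝ V]
    (R : Set V) (hR : IsRootSystem R)
    (hlen : ∀ r ∈ R, ⟪r, r⟫ = 1 ∨ ⟪r, r⟫ = 2)
    (β : V) (α : Fin 3 → V)
    (hβ : β = α 0 + α 1 + α 2)
    (hq : ∀ i, ⟪β, α i⟫ = 1 / 4)
    (hmem : ∀ i, ∀ ε₁ ε₂ : ℝ, (ε₁ = 1 ∨ ε₁ = -1) → (ε₂ = 1 ∨ ε₂ = -1) →
      ε₁ • α i + ε₂ • β ∈ R) :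
    ‖β‖ ^ 2 = 3 / 4 ∧
    (∀ i, ‖α i‖ ^ 2 = 3 / 4) ∧
    (∀ i j, i ≠ j → ⟪α i, α j⟫ = -(1 / 4)) ∧
    (∀ i j, i ≠ j → α i - α j ∈ R) ∧
    (∀ i j, ⟪β - α i, β - α j⟫ = if i = j then 1 else 0) := by
  obtain ⟨-, -, -, -, hrefl⟩ := hR
  have hadd : ∀ i, β + α i ∈ R := fun i => by
    simpa [add_comm] using hmem i 1 1 (Or.inl rfl) (Or.inl rfl)
  have hsub : ∀ i, β - α i ∈ R := fun i => by
    simpa [sub_eq_neg_add] using hmem i (-1) 1 (Or.inr rfl) (Or.inl rfl)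
  have hββ : ⟪β, β⟫ = 3 / 4 := by
    have h : ⟪β, β⟫ = ⟪β, α 0⟫ + ⟪β, α 1⟫ + ⟪β, α 2⟫ := by
      rw [← inner_add_right, ← inner_add_right, ← hβ]
    rw [h, hq, hq, hq]; norm_num
  have hq' : ∀ i, ⟪α i, β⟫ = 1 / 4 := fun i => by rw [real_inner_comm, hq]
  have hαα : ∀ i, ⟪α i, α i⟫ = 3 / 4 := by
    intro i
    have h₁ := hlen _ (hadd i)
    have h₂ := hlen _ (hsub i)
    simp only [inner_add_left, inner_add_right, inner_sub_left, inner_sub_right,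
      hββ, hq, hq'] at h₁ h₂
    rcases h₁ with h₁ | h₁ <;> rcases h₂ with h₂ | h₂ <;> linarith
  have hαβ : ∀ i, ⟪α i, α 0⟫ + ⟪α i, α 1⟫ + ⟪α i, α 2⟫ = 1 / 4 := fun i => by
    rw [← inner_add_right, ← inner_add_right, ← hβ, hq']
  have hαne : ∀ i j, i ≠ j → ⟪α i, α j⟫ = -(1 / 4) := by
    have h₀ := hαβ 0
    have h₁ := hαβ 1
    have h₂ := hαβ 2
    rw [hαα] at h₀ h₁ h₂
    have c₀₁ := real_inner_comm (α 0) (α 1)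
    have c₀₂ := real_inner_comm (α 0) (α 2)
    have c₁₂ := real_inner_comm (α 1) (α 2)
    intro i j hij
    fin_cases i <;> fin_cases j <;>
      first
      | exact absurd rfl hij
      | (simp only [Fin.zero_eta, Fin.mk_one, Fin.reduceFinMk]; linarith)
  have hγγ : ∀ i j, ⟪β - α i, β - α j⟫ = if i = j then 1 else 0 := by
    intro i j
    simp only [inner_sub_left, inner_sub_right, hββ, hq, hq']
    split_ifs with h
    · rw [h, hαα]; norm_num
    · rw [hαne i j h]; norm_num
  refine ⟨by rw [← real_inner_self_eq_norm_sq, hββ],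
    fun i => by rw [← real_inner_self_eq_norm_sq, hαα], hαne, ?_, hγγ⟩
  intro i j hij
  obtain ⟨k, hki, hkj, huniv⟩ : ∃ k, i ≠ k ∧ j ≠ k ∧ Finset.univ = {i, j, k} := by
    clear * - hij
    decide +revert
  have hsum : β = α i + (α j + α k) := by
    rw [hβ, ← Fin.sum_univ_three, huniv, Finset.sum_insert (by simp [hij, hki]),
      Finset.sum_pair hkj]
  -- `β + α k` is the sum of the orthogonal roots `β - α i` and `β - α j`.
  have hinner : ⟪β - α i, β + α k⟫ = 1 := by
    simp only [inner_sub_left, inner_add_right, hββ, hq, hq', hαne i k hki]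
    norm_num
  have h := hrefl _ (hsub i) _ (hadd k)
  rw [hinner, hγγ, if_pos rfl] at h
  convert h using 1
  rw [hsum]
  module
end

section
/- Let V be a real inner product space and let R ⊆ V be a root system all of whose elements have square length 1 or 2. Suppose β, α₁, α₂, α₃, α₄ ∈ V are such that: the 16 vectors ε·αᵢ + ε′·β (1 ≤ i ≤ 4, ε, ε′ ∈ {1, −1}) are pairwise distinct and all lie in R; β = α₁ + α₂ + α₃; ⟨β, αᵢ⟩ = 1/4 for i = 1, 2, 3; and ⟨β, α₄⟩ = 0. Then ‖β + α₄‖² = 1 and ‖β − α₄‖² = 1 (equivalently, ‖α₄‖² = 1/4). -/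
open scoped RealInnerProductSpace

theorem statement12 {V : Type*} [NormedAddCommGroup V] [InnerProductSpace ℝ V]
    (R : Set V) (hR : IsRootSystem R)
    (hlen : ∀ r ∈ R, ⟪r, r⟫ = 1 ∨ ⟪r, r⟫ = 2)
    (β : V) (α : Fin 4 → V)
    (hdist : ∀ i j : Fin 4, ∀ ε₁ ε₂ η₁ η₂ : ℝ,
      (ε₁ = 1 ∨ ε₁ = -1) → (ε₂ = 1 ∨ ε₂ = -1) → (η₁ = 1 ∨ η₁ = -1) → (η₂ = 1 ∨ η₂ = -1) →
      ε₁ • α i + ε₂ • β = η₁ • α j + η₂ • β → i = j ∧ ε₁ = η₁ ∧ ε₂ = η₂)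
    (hmem : ∀ i : Fin 4, ∀ ε₁ ε₂ : ℝ, (ε₁ = 1 ∨ ε₁ = -1) → (ε₂ = 1 ∨ ε₂ = -1) →
      ε₁ • α i + ε₂ • β ∈ R)
    (hβ : β = α 0 + α 1 + α 2)
    (hq : ⟪β, α 0⟫ = 1 / 4 ∧ ⟪β, α 1⟫ = 1 / 4 ∧ ⟪β, α 2⟫ = 1 / 4)
    (h4 : ⟪β, α 3⟫ = 0) :
    ‖β + α 3‖ ^ 2 = 1 ∧ ‖β - α 3‖ ^ 2 = 1 ∧ ‖α 3‖ ^ 2 = 1 / 4 := by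
  obtain ⟨-, -, -, hint, -⟩ := hR
  have hββ : ⟪β, β⟫ = 3 / 4 := by
    calc ⟪β, β⟫ = ⟪β, α 0 + α 1 + α 2⟫ := by rw [← hβ]
      _ = 3 / 4 := by rw [inner_add_right, inner_add_right, hq.1, hq.2.1, hq.2.2]; norm_num
  have hadd : β + α 3 ∈ R := by
    have := hmem 3 1 1 (Or.inl rfl) (Or.inl rfl)
    rwa [one_smul, one_smul, add_comm] at this
  have hsub : ∀ i, β - α i ∈ R := fun i => by
    have := hmem i (-1) 1 (Or.inr rfl) (Or.inl rfl)
    rwa [neg_one_smul, one_smul, neg_add_eq_sub] at this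
  have hnorm : ⟪β + α 3, β + α 3⟫ = 3 / 4 + ⟪α 3, α 3⟫ := by
    rw [real_inner_add_add_self, hββ, h4]; ring
  have hone : ⟪β + α 3, β + α 3⟫ = 1 := by
    refine (hlen _ hadd).resolve_right fun htwo => ?_
    -- If `β + α 3` is long, its products with the roots `β - α i` are integers with sum `3 / 2`.
    have hsum : ⟪β + α 3, β - α 0⟫ + ⟪β + α 3, β - α 1⟫ + ⟪β + α 3, β - α 2⟫ = 3 / 2 := by
      have hv : (β - α 0) + (β - α 1) + (β - α 2) = (2 : ℝ) • β := by
        calc _ = (3 : ℝ) • β - (α 0 + α 1 + α 2) := by module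
          _ = (2 : ℝ) • β := by rw [← hβ]; module
      rw [← inner_add_right, ← inner_add_right, hv, inner_smul_right, inner_add_left, hββ,
        real_inner_comm, h4]
      norm_num
    have hZ : ∀ i, ∃ k : ℤ, ⟪β + α 3, β - α i⟫ = k := fun i => by
      obtain ⟨k, hk⟩ := hint _ hadd _ (hsub i)
      exact ⟨k, by rw [← hk, htwo]; ring⟩
    obtain ⟨k₀, h₀⟩ := hZ 0
    obtain ⟨k₁, h₁⟩ := hZ 1
    obtain ⟨k₂, h₂⟩ := hZ 2
    rw [h₀, h₁, h₂] at hsum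
    have : 2 * (k₀ + k₁ + k₂) = 3 := by
      have : (2 * (k₀ + k₁ + k₂) : ℝ) = 3 := by linarith
      exact_mod_cast this
    omega
  simp only [← real_inner_self_eq_norm_sq]
  refine ⟨hone, ?_, by linarith⟩
  rw [real_inner_sub_sub_self, hββ, h4]
  linarith
end

section
/- In ℝ³ with standard orthonormal basis e₁, e₂, e₃, let R := {±eᵢ : 1 ≤ i ≤ 3} ∪ {±eᵢ ± eⱼ : 1 ≤ i < j ≤ 3} (the root system of SO(7)), let β := (e₁ + e₂ + e₃)/2 and αᵢ := β − eᵢ for i = 1, 2, 3. Then: (i) R is a root system and every element of R has square length 1 or 2; (ii) β = α₁ + α₂ + α₃, ‖β‖² = 3/4, and ⟨β, αᵢ⟩ = 1/4 for each i; (iii) the 12 vectors ε·αᵢ + ε′·β (1 ≤ i ≤ 3, ε, ε′ ∈ {1, −1}) are pairwise distinct and their set W equals {±e₁, ±e₂, ±e₃} ∪ {±(eᵢ + eⱼ) : 1 ≤ i < j ≤ 3}; (iv) S := R \ W equals {eᵢ − eⱼ : 1 ≤ i, j ≤ 3, i ≠ j} (the root system of SU(3)) and S is closed; (v) there exist w₁,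 w₂, w₃ ∈ W with w₁ + w₂ = w₃ (for instance e₁ + e₂ = (e₁) + (e₂)). -/
open scoped RealInnerProductSpace

/-- The standard orthonormal basis of ℝ³. -/
noncomputable def e3 (i : Fin 3) : EuclideanSpace ℝ (Fin 3) :=
  EuclideanSpace.single i 1

/-- The root system of SO(7): `{±eᵢ} ∪ {±eᵢ ± eⱼ : i < j}`. -/
noncomputable def RB3 : Set (EuclideanSpace ℝ (Fin 3)) :=
  {v | (∃ i, v = e3 i ∨ v = -(e3 i)) ∨
       (∃ i j, i < j ∧ (v = e3 i + e3 j ∨ v = e3 i - e3 j ∨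
         v = -(e3 i) + e3 j ∨ v = -(e3 i) - e3 j))}

noncomputable def βB3 : EuclideanSpace ℝ (Fin 3) := (1 / 2 : ℝ) • (e3 0 + e3 1 + e3 2)

noncomputable def αB3 (i : Fin 3) : EuclideanSpace ℝ (Fin 3) := βB3 - e3 i

noncomputable def WB3 : Set (EuclideanSpace ℝ (Fin 3)) :=
  {v | ∃ i : Fin 3, ∃ ε₁ ε₂ : ℝ,
    (ε₁ = 1 ∨ ε₁ = -1) ∧ (ε₂ = 1 ∨ ε₂ = -1) ∧ v = ε₁ • αB3 i + ε₂ • βB3}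

/-- The point of `ℝ³` with the given integer coordinates. -/
noncomputable def latticePoint (x : Fin 3 → ℤ) : EuclideanSpace ℝ (Fin 3) :=
  WithLp.toLp 2 (fun i => (x i : ℝ))

@[simp] lemma latticePoint_apply (x : Fin 3 → ℤ) (i : Fin 3) : latticePoint x i = x i := rfl

lemma latticePoint_injective : Function.Injective latticePoint := by
  intro x y h
  funext i
  have := congrArg (fun v : EuclideanSpace ℝ (Fin 3) => v i) h
  simpa using this

lemma latticePoint_zero : latticePoint 0 = 0 := by ext i; simp

lemma latticePoint_add (x y : Fin 3 → ℤ) :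
    latticePoint (x + y) = latticePoint x + latticePoint y := by ext i; simp

lemma latticePoint_sub (x y : Fin 3 → ℤ) :
    latticePoint (x - y) = latticePoint x - latticePoint y := by ext i; simp

lemma latticePoint_neg (x : Fin 3 → ℤ) : latticePoint (-x) = -latticePoint x := by ext i; simp

lemma latticePoint_smul (k : ℤ) (x : Fin 3 → ℤ) :
    latticePoint (k • x) = (k : ℝ) • latticePoint x := by ext i; simp

lemma inner_latticePoint (x y : Fin 3 → ℤ) :
    ⟪latticePoint x, latticePoint y⟫ = ((x ⬝ᵥ y : ℤ) : ℝ) := by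
  simp [PiLp.inner_apply, dotProduct, mul_comm]

lemma e3_eq_latticePoint (i : Fin 3) : e3 i = latticePoint (Pi.single i 1) := by
  ext k
  by_cases h : k = i
  · subst h; simp [e3]
  · simp [e3, h]

/-- The integer coordinate vectors of the roots in `RB3`. -/
def rootCoords : Finset (Fin 3 → ℤ) :=
  (Fintype.piFinset fun _ => {-1, 0, 1}).filter fun x => x ⬝ᵥ x = 1 ∨ x ⬝ᵥ x = 2

/-- The coordinates of `s • αB3 i + t • βB3` for signs `s` and `t`. -/
def weightCoords (i : Fin 3) (s t : ℤ) : Fin 3 → ℤ :=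
  fun k => (s + t) / 2 - s * (Pi.single i 1 : Fin 3 → ℤ) k

set_option maxRecDepth 100000 in
lemma exists_single_of_mem_rootCoords : ∀ x ∈ rootCoords,
    (∃ i, x = Pi.single i 1 ∨ x = -(Pi.single i 1)) ∨
    (∃ i j : Fin 3, i < j ∧ (x = Pi.single i 1 + Pi.single j 1 ∨ x = Pi.single i 1 - Pi.single j 1 ∨
      x = -(Pi.single i 1) + Pi.single j 1 ∨ x = -(Pi.single i 1) - Pi.single j 1)) := by
  decide

lemma single_mem_rootCoords (i : Fin 3) :
    Pi.single i 1 ∈ rootCoords ∧ -(Pi.single i 1) ∈ rootCoords := by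
  revert i; decide

lemma single_pair_mem_rootCoords {i j : Fin 3} (h : i < j) :
    Pi.single i 1 + Pi.single j 1 ∈ rootCoords ∧ Pi.single i 1 - Pi.single j 1 ∈ rootCoords ∧
    -(Pi.single i 1) + Pi.single j 1 ∈ rootCoords ∧
    -(Pi.single i 1) - Pi.single j 1 ∈ rootCoords := by
  revert i j; decide

lemma RB3_eq_image : RB3 = latticePoint '' (rootCoords : Set (Fin 3 → ℤ)) := by
  ext v
  simp only [RB3, e3_eq_latticePoint, ← latticePoint_add, ← latticePoint_sub, ← latticePoint_neg,
    Set.mem_ofPred_eq, Set.mem_image, Finset.mem_coe]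
  constructor
  · rintro (⟨i, rfl | rfl⟩ | ⟨i, j, h, rfl | rfl | rfl | rfl⟩)
    · exact ⟨_, (single_mem_rootCoords i).1, rfl⟩
    · exact ⟨_, (single_mem_rootCoords i).2, rfl⟩
    · exact ⟨_, (single_pair_mem_rootCoords h).1, rfl⟩
    · exact ⟨_, (single_pair_mem_rootCoords h).2.1, rfl⟩
    · exact ⟨_, (single_pair_mem_rootCoords h).2.2.1, rfl⟩
    · exact ⟨_, (single_pair_mem_rootCoords h).2.2.2, rfl⟩
  · rintro ⟨x, hx, rfl⟩
    simpa only [latticePoint_injective.eq_iff] using exists_single_of_mem_rootCoords x hx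

set_option maxRecDepth 100000 in
set_option maxHeartbeats 2000000 in
lemma rootCoords_reflection : ∀ x ∈ rootCoords, ∀ y ∈ rootCoords,
    2 * (x ⬝ᵥ y) = (2 * (x ⬝ᵥ y) / (x ⬝ᵥ x)) * (x ⬝ᵥ x) ∧
    y - (2 * (x ⬝ᵥ y) / (x ⬝ᵥ x)) • x ∈ rootCoords := by
  decide

lemma rootCoords_dotProduct {x : Fin 3 → ℤ} (hx : x ∈ rootCoords) :
    x ⬝ᵥ x = 1 ∨ x ⬝ᵥ x = 2 :=
  (Finset.mem_filter.1 hx).2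

lemma rootCoords_apply {x : Fin 3 → ℤ} (hx : x ∈ rootCoords) (i : Fin 3) :
    x i = -1 ∨ x i = 0 ∨ x i = 1 := by
  simpa using Fintype.mem_piFinset.1 (Finset.mem_filter.1 hx).1 i

lemma zero_notMem_rootCoords : (0 : Fin 3 → ℤ) ∉ rootCoords := fun h => by
  simpa using rootCoords_dotProduct h

lemma cartan_eq {x y : Fin 3 → ℤ} (hx : x ∈ rootCoords) (hy : y ∈ rootCoords) :
    2 * ⟪latticePoint x, latticePoint y⟫ / ⟪latticePoint x, latticePoint x⟫ =
      ((2 * (x ⬝ᵥ y) / (x ⬝ᵥ x) : ℤ) : ℝ) := by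
  have h := (rootCoords_reflection x hx y hy).1
  have h0 : ((x ⬝ᵥ x : ℤ) : ℝ) ≠ 0 := by
    rcases rootCoords_dotProduct hx with h | h <;> simp [h]
  rw [inner_latticePoint, inner_latticePoint, div_eq_iff h0]
  exact_mod_cast h

lemma isRootSystem_RB3 : IsRootSystem RB3 := by
  rw [RB3_eq_image]
  refine ⟨rootCoords.finite_toSet.image _, ?_, ?_, ?_, ?_⟩
  · rintro ⟨x, hx, h⟩
    rw [← latticePoint_zero] at h
    exact zero_notMem_rootCoords (latticePoint_injective h ▸ hx)
  · rintro _ ⟨x, hx, rfl⟩ t ⟨y, hy, h⟩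
    obtain ⟨i, hi⟩ : ∃ i, x i ≠ 0 := by
      by_contra! h0
      exact zero_notMem_rootCoords ((funext h0 : x = 0) ▸ hx)
    have hc : (y i : ℝ) = t * x i := congrArg (fun v : EuclideanSpace ℝ (Fin 3) => v i) h
    have ht : t = 0 ∨ t = 1 ∨ t = -1 := by
      rcases rootCoords_apply hx i with h1 | h1 | h1
      · rcases rootCoords_apply hy i with h2 | h2 | h2 <;> rw [h1, h2] at hc <;>
          push_cast at hc <;> grind
      · exact absurd h1 hi
      · rcases rootCoords_apply hy i with h2 | h2 | h2 <;> rw [h1, h2] at hc <;>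
          push_cast at hc <;> grind
    rcases ht with rfl | rfl | rfl
    · rw [zero_smul, ← latticePoint_zero] at h
      exact absurd (latticePoint_injective h ▸ hy) zero_notMem_rootCoords
    · simp
    · simp
  · rintro _ ⟨x, hx, rfl⟩ _ ⟨y, hy, rfl⟩
    exact ⟨_, cartan_eq hx hy⟩
  · rintro _ ⟨x, hx, rfl⟩ _ ⟨y, hy, rfl⟩
    rw [cartan_eq hx hy, ← latticePoint_smul, ← latticePoint_sub]
    exact ⟨_, (rootCoords_reflection x hx y hy).2, rfl⟩

lemma βB3_apply (k : Fin 3) : βB3 k = 1 / 2 := by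
  fin_cases k <;> simp [βB3, e3_eq_latticePoint]

lemma αB3_apply (i k : Fin 3) : αB3 i k = 1 / 2 - ((Pi.single i 1 : Fin 3 → ℤ) k : ℝ) := by
  simp only [αB3, PiLp.sub_apply, βB3_apply, e3_eq_latticePoint, latticePoint_apply]

lemma signed_weight_eq (i : Fin 3) {s t : ℤ} (hs : s = 1 ∨ s = -1) (ht : t = 1 ∨ t = -1) :
    (s : ℝ) • αB3 i + (t : ℝ) • βB3 = latticePoint (weightCoords i s t) := by
  ext k
  simp only [PiLp.add_apply, PiLp.smul_apply, smul_eq_mul, αB3_apply, βB3_apply,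
    latticePoint_apply, weightCoords]
  rcases hs with rfl | rfl <;> rcases ht with rfl | rfl <;> norm_num <;> ring

lemma exists_int_sign {ε : ℝ} (h : ε = 1 ∨ ε = -1) : ∃ s : ℤ, (s = 1 ∨ s = -1) ∧ (s : ℝ) = ε := by
  rcases h with rfl | rfl
  · exact ⟨1, by simp⟩
  · exact ⟨-1, by simp⟩

lemma weightCoords_injective {i j : Fin 3} {s t s' t' : ℤ} (hs : s = 1 ∨ s = -1)
    (ht : t = 1 ∨ t = -1) (hs' : s' = 1 ∨ s' = -1) (ht' : t' = 1 ∨ t' = -1)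
    (h : weightCoords i s t = weightCoords j s' t') : i = j ∧ s = s' ∧ t = t' := by
  rcases hs with rfl | rfl <;> rcases ht with rfl | rfl <;> rcases hs' with rfl | rfl <;>
    rcases ht' with rfl | rfl <;> revert i j <;> decide

/-- The coordinates of the elements of `WB3`. -/
def weightSet : Finset (Fin 3 → ℤ) :=
  Finset.univ.biUnion fun i : Fin 3 =>
    {weightCoords i 1 1, weightCoords i 1 (-1), weightCoords i (-1) 1, weightCoords i (-1) (-1)}

lemma WB3_eq_image : WB3 = latticePoint '' (weightSet : Set (Fin 3 → ℤ)) := by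
  ext v
  simp only [WB3, Set.mem_ofPred_eq, Set.mem_image, Finset.mem_coe]
  constructor
  · rintro ⟨i, ε₁, ε₂, h₁, h₂, rfl⟩
    obtain ⟨s, hs, rfl⟩ := exists_int_sign h₁
    obtain ⟨t, ht, rfl⟩ := exists_int_sign h₂
    refine ⟨_, ?_, (signed_weight_eq i hs ht).symm⟩
    rcases hs with rfl | rfl <;> rcases ht with rfl | rfl <;> simp [weightSet] <;>
      exact ⟨i, by simp⟩
  · rintro ⟨x, hx, rfl⟩
    have key : ∃ i s t, (s = 1 ∨ s = -1) ∧ (t = 1 ∨ t = -1) ∧ x = weightCoords i s t := by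
      simp only [weightSet, Finset.mem_biUnion, Finset.mem_univ, true_and, Finset.mem_insert,
        Finset.mem_singleton] at hx
      obtain ⟨i, h | h | h | h⟩ := hx <;> exact ⟨i, _, _, by simp, by simp, h⟩
    obtain ⟨i, s, t, hs, ht, rfl⟩ := key
    refine ⟨i, s, t, ?_, ?_, (signed_weight_eq i hs ht).symm⟩ <;> exact_mod_cast ‹_›

set_option maxRecDepth 100000 in
lemma exists_single_of_mem_weightSet : ∀ x ∈ weightSet,
    (∃ i, x = Pi.single i 1 ∨ x = -(Pi.single i 1)) ∨
    (∃ i j : Fin 3, i < j ∧ (x = Pi.single i 1 + Pi.single j 1 ∨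
      x = -(Pi.single i 1 + Pi.single j 1))) := by
  decide

lemma single_mem_weightSet (i : Fin 3) :
    Pi.single i 1 ∈ weightSet ∧ -(Pi.single i 1) ∈ weightSet := by
  revert i; decide

lemma single_add_mem_weightSet {i j : Fin 3} (h : i < j) :
    Pi.single i 1 + Pi.single j 1 ∈ weightSet ∧
    -(Pi.single i 1 + Pi.single j 1) ∈ weightSet := by
  revert i j; decide

lemma WB3_eq : WB3 = {v | ∃ i, v = e3 i ∨ v = -(e3 i)} ∪
    {v | ∃ i j, i < j ∧ (v = e3 i + e3 j ∨ v = -(e3 i + e3 j))} := by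
  rw [WB3_eq_image]
  ext v
  simp only [e3_eq_latticePoint, ← latticePoint_add, ← latticePoint_neg, Set.mem_union,
    Set.mem_ofPred_eq, Set.mem_image, Finset.mem_coe]
  constructor
  · rintro ⟨x, hx, rfl⟩
    simpa only [latticePoint_injective.eq_iff] using exists_single_of_mem_weightSet x hx
  · rintro (⟨i, rfl | rfl⟩ | ⟨i, j, h, rfl | rfl⟩)
    · exact ⟨_, (single_mem_weightSet i).1, rfl⟩
    · exact ⟨_, (single_mem_weightSet i).2, rfl⟩
    · exact ⟨_, (single_add_mem_weightSet h).1, rfl⟩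
    · exact ⟨_, (single_add_mem_weightSet h).2, rfl⟩

lemma RB3_diff_WB3_eq_image :
    RB3 \ WB3 = latticePoint '' ((rootCoords \ weightSet : Finset (Fin 3 → ℤ)) : Set _) := by
  rw [RB3_eq_image, WB3_eq_image, Finset.coe_sdiff, Set.image_sdiff latticePoint_injective]

set_option maxRecDepth 100000 in
lemma exists_single_sub_of_mem_sdiff : ∀ x ∈ rootCoords \ weightSet,
    ∃ i j : Fin 3, i ≠ j ∧ x = Pi.single i 1 - Pi.single j 1 := by
  decide

lemma single_sub_mem_sdiff {i j : Fin 3} (h : i ≠ j) :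
    Pi.single i 1 - Pi.single j 1 ∈ rootCoords \ weightSet := by
  revert i j; decide

lemma RB3_diff_WB3_eq : RB3 \ WB3 = {v | ∃ i j, i ≠ j ∧ v = e3 i - e3 j} := by
  rw [RB3_diff_WB3_eq_image]
  ext v
  simp only [e3_eq_latticePoint, ← latticePoint_sub, Set.mem_ofPred_eq, Set.mem_image,
    Finset.mem_coe]
  constructor
  · rintro ⟨x, hx, rfl⟩
    simpa only [latticePoint_injective.eq_iff] using exists_single_sub_of_mem_sdiff x hx
  · rintro ⟨i, j, h, rfl⟩
    exact ⟨_, single_sub_mem_sdiff h, rfl⟩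

set_option maxRecDepth 100000 in
lemma add_mem_sdiff : ∀ x ∈ rootCoords \ weightSet, ∀ y ∈ rootCoords \ weightSet,
    x + y ∈ rootCoords → x + y ∈ rootCoords \ weightSet := by
  decide

lemma isClosedIn_RB3_diff_WB3 : IsClosedIn RB3 (RB3 \ WB3) := by
  rw [RB3_diff_WB3_eq_image, RB3_eq_image]
  rintro _ ⟨x, hx, rfl⟩ _ ⟨y, hy, rfl⟩ h
  rw [← latticePoint_add] at h ⊢
  rw [latticePoint_injective.mem_set_image] at h ⊢
  exact add_mem_sdiff x hx y hy h

theorem statement15 :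
    (IsRootSystem RB3 ∧ ∀ r ∈ RB3, ⟪r, r⟫ = 1 ∨ ⟪r, r⟫ = 2) ∧
    (βB3 = αB3 0 + αB3 1 + αB3 2 ∧ ‖βB3‖ ^ 2 = 3 / 4 ∧ ∀ i, ⟪βB3, αB3 i⟫ = 1 / 4) ∧
    ((∀ i j : Fin 3, ∀ ε₁ ε₂ η₁ η₂ : ℝ,
        (ε₁ = 1 ∨ ε₁ = -1) → (ε₂ = 1 ∨ ε₂ = -1) → (η₁ = 1 ∨ η₁ = -1) → (η₂ = 1 ∨ η₂ = -1) →
        ε₁ • αB3 i + ε₂ • βB3 = η₁ • αB3 j + η₂ • βB3 → i = j ∧ ε₁ = η₁ ∧ ε₂ = η₂) ∧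
      WB3 = {v | ∃ i, v = e3 i ∨ v = -(e3 i)} ∪
            {v | ∃ i j, i < j ∧ (v = e3 i + e3 j ∨ v = -(e3 i + e3 j))}) ∧
    (RB3 \ WB3 = {v | ∃ i j, i ≠ j ∧ v = e3 i - e3 j} ∧ IsClosedIn RB3 (RB3 \ WB3)) ∧
    (∃ w₁ ∈ WB3, ∃ w₂ ∈ WB3, ∃ w₃ ∈ WB3, w₁ + w₂ = w₃) := by
  refine ⟨⟨isRootSystem_RB3, ?_⟩, ⟨?_, ?_, ?_⟩, ⟨?_, WB3_eq⟩,
    ⟨RB3_diff_WB3_eq, isClosedIn_RB3_diff_WB3⟩, ?_⟩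
  · rw [RB3_eq_image]
    rintro _ ⟨x, hx, rfl⟩
    rw [inner_latticePoint]
    exact_mod_cast rootCoords_dotProduct hx
  · ext k
    simp only [PiLp.add_apply, αB3_apply, βB3_apply]
    fin_cases k <;> norm_num [Pi.single_apply, Fin.ext_iff]
  · rw [EuclideanSpace.norm_sq_eq]
    norm_num [βB3_apply]
  · intro i
    simp only [PiLp.inner_apply, αB3_apply, βB3_apply, Fin.sum_univ_three]
    fin_cases i <;> norm_num [Pi.single_apply, Fin.ext_iff]
  · intro i j ε₁ ε₂ η₁ η₂ h₁ h₂ h₃ h₄ h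
    obtain ⟨s, hs, rfl⟩ := exists_int_sign h₁
    obtain ⟨t, ht, rfl⟩ := exists_int_sign h₂
    obtain ⟨s', hs', rfl⟩ := exists_int_sign h₃
    obtain ⟨t', ht', rfl⟩ := exists_int_sign h₄
    rw [signed_weight_eq i hs ht, signed_weight_eq j hs' ht'] at h
    exact_mod_cast weightCoords_injective hs ht hs' ht' (latticePoint_injective h)
  · rw [WB3_eq]
    exact ⟨e3 0, .inl ⟨0, .inl rfl⟩, e3 1, .inl ⟨1, .inl rfl⟩, e3 0 + e3 1,
      .inr ⟨0, 1, by decide, .inl rfl⟩, rfl⟩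
end
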